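/- arXiv:2012.04523 — 9 statements merged into one kernel-verified Lean document; each statement's English description precedes it below -/
import Mathlib

section
/- Let p be a prime with p ≡ 3 (mod 4). Then ∑_{k=0}^{p-1} T_k(2,-1)^2 / (-8)^k ≡ 0 (mod p^2), the left side being a p-adic integer. -/
/-- The generalized central trinomial coefficient `T_n(b,c)`, the coefficient of `x^n`
in `(x^2 + b*x + c)^n`. -/
def genCentralTrinomial (b c : ℤ) (n : ℕ) : ℤ :=
  ∑ k ∈ Finset.range (n / 2 + 1),
    (n.choose (2 * k) : ℤ) * ((2 * k).choose k : ℤ) * b ^ (n - 2 * k) * c ^ k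

open Finset

section Field

variable {K : Type*} [Field K]

theorem cast_choose_succ_right [CharZero K] (n j : ℕ) :
    (n.choose (j + 1) : K) = n.choose j * (n - j) / (j + 1) := by
  have hj : (j + 1 : K) ≠ 0 := by exact_mod_cast j.succ_ne_zero
  rw [eq_div_iff hj]
  rcases le_or_gt j n with h | h
  · have := Nat.choose_succ_right_eq n j
    rw [← Nat.cast_sub h]
    exact_mod_cast this
  · simp [Nat.choose_eq_zero_of_lt h, Nat.choose_eq_zero_of_lt (h.trans j.lt_succ_self)]

theorem cast_centralBinom_succ [CharZero K] (k : ℕ) :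
    ((k + 1).centralBinom : K) = 2 * (2 * k + 1) * k.centralBinom / (k + 1) := by
  have hk : (k + 1 : K) ≠ 0 := by exact_mod_cast k.succ_ne_zero
  rw [eq_div_iff hk]
  have := Nat.succ_mul_centralBinom_succ k
  rw [mul_comm]
  exact_mod_cast this

theorem sum_range_succ_eq_add_of_shift {f g h : ℕ → K} {N : ℕ} (h0 : f 0 = g 0)
    (hs : ∀ k, f (k + 1) = g (k + 1) + h k) (hN : h N = 0) :
    ∑ k ∈ range (N + 1), f k = ∑ k ∈ range (N + 1), g k + ∑ k ∈ range (N + 1), h k := by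
  rw [sum_range_succ' f, sum_range_succ' g, sum_range_succ h, hN, h0,
    sum_congr rfl fun k _ => hs k, sum_add_distrib]
  ring

/-- The central trinomial sum `T_n(1, y)`, with summation range `k ≤ N`. -/
def trinomialSum (y : K) (N n : ℕ) : K :=
  ∑ k ∈ range (N + 1), (n.choose (2 * k) : K) * k.centralBinom * y ^ k

/-- The Legendre-type sum `∑ binom(n+k,2k) binom(2k,k) y^k`, with summation range `k ≤ N`. -/
def legendreSum (y : K) (N n : ℕ) : K :=
  ∑ k ∈ range (N + 1), ((n + k).choose (2 * k) : K) * k.centralBinom * y ^ k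

/-- The sum `∑ binom(n+k,2k) binom(2k,k)^2 z^k`, with summation range `k ≤ N`. -/
def clausenSum (z : K) (N n : ℕ) : K :=
  ∑ k ∈ range (N + 1), ((n + k).choose (2 * k) : K) * k.centralBinom ^ 2 * z ^ k

/-- The sum `∑ (n+1+k) binom(n+k,2k) binom(2k,k)^2 z^k`, with summation range `k ≤ N`. -/
def weightedClausenSum (z : K) (N n : ℕ) : K :=
  ∑ k ∈ range (N + 1),
    (n + 1 + k : K) * (((n + k).choose (2 * k) : K) * k.centralBinom ^ 2 * z ^ k)

theorem trinomialSum_recurrence [CharZero K] (y : K) {N n : ℕ} (hn : n + 2 ≤ N) :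
    (n + 2 : K) * trinomialSum y N (n + 2) =
      (2 * n + 3) * trinomialSum y N (n + 1) - (n + 1) * (1 - 4 * y) * trinomialSum y N n := by
  have key := sum_range_succ_eq_add_of_shift (N := N)
    (f := fun k => (n + 2 : K) * (((n + 2).choose (2 * k) : K) * k.centralBinom * y ^ k))
    (g := fun k => (2 * n + 3 : K) * (((n + 1).choose (2 * k) : K) * k.centralBinom * y ^ k)
      - (n + 1) * ((n.choose (2 * k) : K) * k.centralBinom * y ^ k))
    (h := fun k => 4 * y * (n + 1) * ((n.choose (2 * k) : K) * k.centralBinom * y ^ k))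
    (by simp; ring)
    (fun k => by
      have h1 : (2 * k + 1 : K) ≠ 0 := by exact_mod_cast (2 * k).succ_ne_zero
      have h2 : (k + 1 : K) ≠ 0 := by exact_mod_cast k.succ_ne_zero
      have h3 : (2 * k + 1 + 1 : K) ≠ 0 := by exact_mod_cast (2 * k + 1).succ_ne_zero
      simp only [show 2 * (k + 1) = 2 * k + 1 + 1 by ring, Nat.choose_succ_succ' (n + 1),
        Nat.choose_succ_succ' n, Nat.cast_add, cast_choose_succ_right, cast_centralBinom_succ]
      push_cast
      field_simp
      ring)
    (by simp [Nat.choose_eq_zero_of_lt (show n < 2 * N by omega)])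
  simp only [sum_sub_distrib, ← mul_sum] at key
  simp only [trinomialSum]
  rw [key]
  ring

theorem legendreSum_recurrence [CharZero K] (y : K) {N n : ℕ} (hn : n + 2 ≤ N) :
    (n + 2 : K) * legendreSum y N (n + 2) =
      (2 * n + 3) * (1 + 2 * y) * legendreSum y N (n + 1) - (n + 1) * legendreSum y N n := by
  have key := sum_range_succ_eq_add_of_shift (N := N)
    (f := fun k => (n + 2 : K) * (((n + 2 + k).choose (2 * k) : K) * k.centralBinom * y ^ k))
    (g := fun k => (2 * n + 3 : K) * (((n + 1 + k).choose (2 * k) : K) * k.centralBinom * y ^ k)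
      - (n + 1) * (((n + k).choose (2 * k) : K) * k.centralBinom * y ^ k))
    (h := fun k => 2 * y * (2 * n + 3) *
      (((n + 1 + k).choose (2 * k) : K) * k.centralBinom * y ^ k))
    (by simp; ring)
    (fun k => by
      have h1 : (2 * k + 1 : K) ≠ 0 := by exact_mod_cast (2 * k).succ_ne_zero
      have h2 : (k + 1 : K) ≠ 0 := by exact_mod_cast k.succ_ne_zero
      have h3 : (2 * k + 1 + 1 : K) ≠ 0 := by exact_mod_cast (2 * k + 1).succ_ne_zero
      simp only [show 2 * (k + 1) = 2 * k + 1 + 1 by ring,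
        show n + 2 + (k + 1) = n + 1 + k + 1 + 1 by ring,
        show n + 1 + (k + 1) = n + 1 + k + 1 by ring,
        show n + (k + 1) = n + 1 + k by ring, Nat.choose_succ_succ' (n + 1 + k + 1),
        Nat.choose_succ_succ' (n + 1 + k), Nat.cast_add, cast_choose_succ_right,
        cast_centralBinom_succ]
      push_cast
      field_simp
      ring)
    (by simp [Nat.choose_eq_zero_of_lt (show n + 1 + N < 2 * N by omega)])
  simp only [sum_sub_distrib, ← mul_sum] at key
  simp only [legendreSum]
  rw [key]
  ring

theorem sub_mul_cast_choose_add (n k : ℕ) :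
    (n + 1 - k : K) * ((n + 1 + k).choose (2 * k) : K) =
      (n + 1 + k) * ((n + k).choose (2 * k) : K) := by
  rcases le_or_gt k (n + 1) with h | h
  · have := Nat.choose_mul_succ_eq (n + k) (2 * k)
    rw [show n + k + 1 - 2 * k = n + 1 - k by omega,
      show n + k + 1 = n + 1 + k by ring] at this
    have h' : ((n + 1 - k : ℕ) : K) = n + 1 - k := by push_cast [Nat.cast_sub h]; ring
    have := congrArg (Nat.cast : ℕ → K) this
    push_cast at this
    rw [h'] at this
    linear_combination -this
  · simp [Nat.choose_eq_zero_of_lt (show n + 1 + k < 2 * k by omega),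
      Nat.choose_eq_zero_of_lt (show n + k < 2 * k by omega)]

theorem weightedClausenSum_succ (z : K) (N n : ℕ) :
    weightedClausenSum z N (n + 1) =
      (2 * n + 3) * clausenSum z N (n + 1) - weightedClausenSum z N n := by
  simp only [weightedClausenSum, clausenSum, mul_sum, ← sum_sub_distrib]
  refine sum_congr rfl fun k _ => ?_
  have := sub_mul_cast_choose_add (K := K) n k
  push_cast
  linear_combination (-(k.centralBinom : K) ^ 2 * z ^ k) * this

theorem clausenSum_recurrence [CharZero K] (z : K) {N n : ℕ} (hn : n + 2 ≤ N) :
    (n + 2 : K) ^ 2 * clausenSum z N (n + 2) =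
      (n + 1) ^ 2 * clausenSum z N n + (2 * n + 3) * (1 + 4 * z) *
        ((2 * n + 3) * clausenSum z N (n + 1) - 2 * weightedClausenSum z N n) := by
  have hw : (2 * n + 3) * clausenSum z N (n + 1) - 2 * weightedClausenSum z N n =
      ∑ k ∈ range (N + 1),
        (2 * k + 1 : K) * (((n + 1 + k).choose (2 * k) : K) * k.centralBinom ^ 2 * z ^ k) := by
    simp only [weightedClausenSum, clausenSum, mul_sum, ← sum_sub_distrib]
    refine sum_congr rfl fun k _ => ?_
    have := sub_mul_cast_choose_add (K := K) n k
    linear_combination (2 * (k.centralBinom : K) ^ 2 * z ^ k) * this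
  have key := sum_range_succ_eq_add_of_shift (N := N)
    (f := fun k => (n + 2 : K) ^ 2 *
      (((n + 2 + k).choose (2 * k) : K) * k.centralBinom ^ 2 * z ^ k))
    (g := fun k => (n + 1 : K) ^ 2 *
        (((n + k).choose (2 * k) : K) * k.centralBinom ^ 2 * z ^ k) +
      (2 * n + 3) * ((2 * k + 1) *
        (((n + 1 + k).choose (2 * k) : K) * k.centralBinom ^ 2 * z ^ k)))
    (h := fun k => (2 * n + 3) * (4 * z) * ((2 * k + 1) *
      (((n + 1 + k).choose (2 * k) : K) * k.centralBinom ^ 2 * z ^ k)))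
    (by simp; ring)
    (fun k => by
      have h1 : (2 * k + 1 : K) ≠ 0 := by exact_mod_cast (2 * k).succ_ne_zero
      have h2 : (k + 1 : K) ≠ 0 := by exact_mod_cast k.succ_ne_zero
      have h3 : (2 * k + 1 + 1 : K) ≠ 0 := by exact_mod_cast (2 * k + 1).succ_ne_zero
      simp only [show 2 * (k + 1) = 2 * k + 1 + 1 by ring,
        show n + 2 + (k + 1) = n + 1 + k + 1 + 1 by ring,
        show n + 1 + (k + 1) = n + 1 + k + 1 by ring,
        show n + (k + 1) = n + 1 + k by ring, Nat.choose_succ_succ' (n + 1 + k + 1),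
        Nat.choose_succ_succ' (n + 1 + k), Nat.cast_add, cast_choose_succ_right,
        cast_centralBinom_succ]
      push_cast
      field_simp
      ring)
    (by simp [Nat.choose_eq_zero_of_lt (show n + 1 + N < 2 * N by omega)])
  simp only [sum_add_distrib, ← mul_sum] at key
  rw [hw]
  simp only [clausenSum]
  rw [key]
  ring

theorem trinomialSum_zero (y : K) (N : ℕ) : trinomialSum y N 0 = 1 := by
  rw [trinomialSum, sum_range_succ', sum_eq_zero fun k _ => by
    rw [Nat.choose_eq_zero_of_lt (by omega)]; simp]
  simp

theorem trinomialSum_one (y : K) (N : ℕ) : trinomialSum y N 1 = 1 := by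
  rw [trinomialSum, sum_range_succ', sum_eq_zero fun k _ => by
    rw [Nat.choose_eq_zero_of_lt (by omega)]; simp]
  simp

theorem clausenSum_zero (z : K) (N : ℕ) : clausenSum z N 0 = 1 := by
  rw [clausenSum, sum_range_succ', sum_eq_zero fun k _ => by
    rw [Nat.choose_eq_zero_of_lt (by omega)]; simp]
  simp

theorem weightedClausenSum_zero (z : K) (N : ℕ) : weightedClausenSum z N 0 = 1 := by
  rw [weightedClausenSum, sum_range_succ', sum_eq_zero fun k _ => by
    rw [Nat.choose_eq_zero_of_lt (show 0 + (k + 1) < 2 * (k + 1) by omega)]; simp]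
  simp

theorem clausenSum_one (z : K) {N : ℕ} (hN : 1 ≤ N) : clausenSum z N 1 = 1 + 4 * z := by
  obtain ⟨N, rfl⟩ := Nat.exists_eq_add_of_le' hN
  rw [clausenSum, sum_range_succ', sum_range_succ', sum_eq_zero fun k _ => by
    rw [Nat.choose_eq_zero_of_lt (by omega)]; simp]
  simp [Nat.centralBinom]
  ring

theorem trinomialSum_sq_and_mul [CharZero K] {y z : K} (hz : (1 - 4 * y) * (1 + 4 * z) = 1)
    {N : ℕ} (n : ℕ) (hn : n + 1 ≤ N) :
    trinomialSum y N n ^ 2 = (1 - 4 * y) ^ n * clausenSum z N n ∧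
    trinomialSum y N (n + 1) ^ 2 = (1 - 4 * y) ^ (n + 1) * clausenSum z N (n + 1) ∧
    (n + 1) * (trinomialSum y N (n + 1) * trinomialSum y N n) =
      (1 - 4 * y) ^ n * weightedClausenSum z N n := by
  induction n with
  | zero =>
    simp [trinomialSum_zero, trinomialSum_one, clausenSum_zero, clausenSum_one z hn,
      weightedClausenSum_zero, hz]
  | succ n ih =>
    obtain ⟨h0, h1, h2⟩ := ih (by omega)
    have hT := trinomialSum_recurrence y (show n + 2 ≤ N by omega)
    have hC := clausenSum_recurrence z (show n + 2 ≤ N by omega)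
    have hW := weightedClausenSum_succ z N n
    have hne : (n + 2 : K) ≠ 0 := by exact_mod_cast (n + 1).succ_ne_zero
    refine ⟨h1, ?_, ?_⟩
    · refine mul_left_cancel₀ (pow_ne_zero 2 hne) ?_
      rw [show n + 1 + 1 = n + 2 from rfl]
      rw [← mul_pow, hT]
      linear_combination (2 * n + 3 : K) ^ 2 * h1 - 2 * (2 * n + 3) * (1 - 4 * y) * h2
        + ((n : K) + 1) ^ 2 * (1 - 4 * y) ^ 2 * h0 - (1 - 4 * y) ^ (n + 2) * hC
        - (1 - 4 * y) ^ (n + 1) * (2 * n + 3) *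
        ((2 * n + 3) * clausenSum z N (n + 1) - 2 * weightedClausenSum z N n) * hz
    · rw [show n + 1 + 1 = n + 2 from rfl]
      push_cast
      linear_combination trinomialSum y N (n + 1) * hT + (2 * n + 3) * h1 - (1 - 4 * y) * h2
        - (1 - 4 * y) ^ (n + 1) * hW

theorem trinomialSum_sq [CharZero K] {y z : K} (hz : (1 - 4 * y) * (1 + 4 * z) = 1) {N n : ℕ}
    (hN : 1 ≤ N) (hn : n ≤ N) :
    trinomialSum y N n ^ 2 = (1 - 4 * y) ^ n * clausenSum z N n := by
  rcases n with _ | n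
  · exact (trinomialSum_sq_and_mul hz 0 hN).1
  · exact (trinomialSum_sq_and_mul hz n hn).2.1

theorem legendreSum_neg_half_odd [CharZero K] {N : ℕ} (j : ℕ) (hj : 2 * j + 1 ≤ N) :
    legendreSum (-1 / 2 : K) N (2 * j + 1) = 0 := by
  induction j with
  | zero =>
    obtain ⟨N, rfl⟩ := Nat.exists_eq_add_of_le' hj
    rw [legendreSum, sum_range_succ', sum_range_succ', sum_eq_zero fun k _ => by
      rw [Nat.choose_eq_zero_of_lt (by omega)]; simp]
    norm_num [Nat.centralBinom]
  | succ j ih =>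
    have h := legendreSum_recurrence (-1 / 2 : K) (show 2 * j + 1 + 2 ≤ N by omega)
    rw [ih (by omega), show (1 + 2 * (-1 / 2) : K) = 0 by norm_num] at h
    have hne : ((2 * j + 1 : ℕ) + 2 : K) ≠ 0 := by exact_mod_cast (2 * j + 2).succ_ne_zero
    rw [show 2 * (j + 1) + 1 = 2 * j + 1 + 2 by ring]
    exact (mul_eq_zero.mp (by simpa using h)).resolve_left (by simpa using hne)

theorem cast_genCentralTrinomial_two_neg_one [CharZero K] {N n : ℕ} (hn : n ≤ N) :
    (genCentralTrinomial 2 (-1) n : K) = 2 ^ n * trinomialSum (-1 / 4) N n := by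
  have h : trinomialSum (-1 / 4 : K) N n =
      ∑ k ∈ range (n / 2 + 1), (n.choose (2 * k) : K) * k.centralBinom * (-1 / 4) ^ k := by
    refine (sum_subset (range_subset_range.mpr (by omega)) fun k _ hk => ?_).symm
    rw [Nat.choose_eq_zero_of_lt (by simp at hk; omega)]
    simp
  rw [h, genCentralTrinomial, mul_sum]
  push_cast
  refine sum_congr rfl fun k hk => ?_
  have h2 : (2 : K) ^ n = 2 ^ (n - 2 * k) * 4 ^ k := by
    rw [show (4 : K) = 2 ^ 2 by norm_num, ← pow_mul, ← pow_add]
    congr 1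
    simp at hk
    omega
  rw [h2, div_pow, Nat.centralBinom]
  field_simp

theorem genCentralTrinomial_sq_div [CharZero K] {N n : ℕ} (hN : 1 ≤ N) (hn : n ≤ N) :
    (genCentralTrinomial 2 (-1) n : K) ^ 2 / (-8) ^ n =
      (-1) ^ n * clausenSum (-1 / 8) N n := by
  rw [cast_genCentralTrinomial_two_neg_one hn, mul_pow,
    trinomialSum_sq (z := -1 / 8) (by norm_num) hN hn, ← pow_mul, mul_comm n 2, pow_mul,
    show (1 - 4 * (-1 / 4) : K) = 2 by norm_num, ← mul_assoc,
    ← mul_pow, show (2 ^ 2 * 2 : K) = -8 * -1 by norm_num, mul_pow]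
  field_simp

end Field

/-- The alternating sum `∑ (-1)^n binom(n+k,2k)` over `n < N`. -/
def altChooseSum (N k : ℕ) : ℤ :=
  ∑ n ∈ range N, (-1) ^ n * ((n + k).choose (2 * k) : ℤ)

theorem altChooseSum_add_four_mul (N k : ℕ) :
    altChooseSum N k + 4 * altChooseSum N (k + 1) =
      -(-1) ^ N * (((N + k + 1).choose (2 * k + 2) : ℤ) + ((N + k).choose (2 * k + 2) : ℤ)) := by
  induction N with
  | zero => simp [altChooseSum, Nat.choose_eq_zero_of_lt (show k + 1 < 2 * k + 2 by omega),
      Nat.choose_eq_zero_of_lt (show k < 2 * k + 2 by omega)]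
  | succ N ih =>
    simp only [altChooseSum, sum_range_succ] at ih ⊢
    rw [show N + 1 + k + 1 = N + k + 1 + 1 by ring, show N + 1 + k = N + k + 1 by ring,
      show N + (k + 1) = N + k + 1 by ring, show 2 * (k + 1) = 2 * k + 1 + 1 by ring]
    simp only [show 2 * (k + 1) = 2 * k + 1 + 1 by ring, show 2 * k + 2 = 2 * k + 1 + 1 by ring,
      Nat.choose_succ_succ' (N + k + 1), Nat.choose_succ_succ' (N + k), Nat.cast_add] at ih ⊢
    rw [pow_succ]
    linear_combination ih

theorem prime_sq_dvd_choose_add_choose {p k : ℕ} (hp : p.Prime) (hk : 2 * k + 2 < p) :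
    p ^ 2 ∣ (p + k + 1).choose (2 * k + 2) + (p + k).choose (2 * k + 2) := by
  have h := Nat.choose_mul_succ_eq (p + k) (2 * k + 2)
  have hsub : p + k + 1 - (2 * k + 2) + (k + 1) = p := by omega
  have hmul : (p + k + 1) * ((p + k + 1).choose (2 * k + 2) + (p + k).choose (2 * k + 2)) =
      2 * p * (p + k + 1).choose (2 * k + 2) := by
    rw [mul_add, mul_comm (p + k + 1) ((p + k).choose _), h]
    zify at hsub ⊢
    linear_combination ((p + k + 1).choose (2 * k + 2) : ℤ) * hsub
  have hd : p ∣ (p + k + 1).choose (2 * k + 2) :=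
    hp.dvd_choose hk (by omega) (by omega)
  have hc : Nat.Coprime (p ^ 2) (p + k + 1) := by
    refine Nat.Coprime.pow_left 2 ((Nat.Prime.coprime_iff_not_dvd hp).mpr fun hdvd => ?_)
    rw [add_assoc, Nat.dvd_add_right dvd_rfl] at hdvd
    exact absurd (Nat.le_of_dvd (by omega) hdvd) (by omega)
  refine hc.dvd_of_dvd_mul_left ?_
  rw [hmul, sq, mul_assoc 2]
  exact (mul_dvd_mul_left p hd).mul_left 2

theorem four_pow_mul_altChooseSum_modEq {p : ℕ} (hp : p.Prime) (hodd : Odd p) (k : ℕ)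
    (hk : 2 * k < p) : 4 ^ k * altChooseSum p k ≡ (-1) ^ k [ZMOD (p : ℤ) ^ 2] := by
  induction k with
  | zero =>
    obtain ⟨j, rfl⟩ := hodd
    have : altChooseSum (2 * j + 1) 0 = 1 := by
      clear hp hk
      induction j with
      | zero => simp [altChooseSum]
      | succ j ih =>
        rw [show 2 * (j + 1) + 1 = 2 * j + 1 + 1 + 1 by ring]
        simp only [altChooseSum] at ih ⊢
        rw [sum_range_succ, sum_range_succ, ih]
        simp [pow_succ]
    simp [this]
  | succ k ih =>
    have h := ih (by omega)
    have hd : (p : ℤ) ^ 2 ∣ altChooseSum p k + 4 * altChooseSum p (k + 1) := by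
      rw [altChooseSum_add_four_mul]
      refine Dvd.dvd.mul_left ?_ _
      exact_mod_cast prime_sq_dvd_choose_add_choose hp (show 2 * k + 2 < p by omega)
    rw [Int.modEq_iff_dvd] at h ⊢
    obtain ⟨u, hu⟩ := h
    obtain ⟨v, hv⟩ := hd
    refine ⟨-u - 4 ^ k * v, ?_⟩
    rw [pow_succ, pow_succ]
    linear_combination -hu - 4 ^ k * hv

theorem neg_sixteen_pow_mul_choose_modEq {p m : ℕ} (hp : p.Prime) (hm : p = 2 * m + 1) (k : ℕ)
    (hk : k ≤ m) :
    (-16) ^ k * ((m + k).choose (2 * k) : ℤ) ≡ (k.centralBinom : ℤ) [ZMOD (p : ℤ) ^ 2] := by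
  induction k with
  | zero => simp
  | succ k ih =>
    have h := ih (by omega)
    rw [Int.modEq_iff_dvd] at h ⊢
    obtain ⟨u, hu⟩ := h
    have hC := Nat.succ_mul_centralBinom_succ k
    have h1 := Nat.choose_succ_right_eq (m + k + 1) (2 * k + 1)
    have h2 := Nat.add_one_mul_choose_eq (m + k) (2 * k)
    rw [show m + k + 1 - (2 * k + 1) = m - k by omega] at h1
    have hmk : ((m - k : ℕ) : ℤ) = m - k := by push_cast [Nat.cast_sub (show k ≤ m by omega)]; rfl
    zify at hC h1 h2
    rw [hmk] at h1
    have hcop : IsCoprime ((p : ℤ) ^ 2) (((2 * k + 1) * (2 * k + 2) : ℕ) : ℤ) := by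
      refine IsCoprime.pow_left (Nat.isCoprime_iff_coprime.mpr ?_)
      refine Nat.Coprime.mul_right ?_ ?_ <;>
      · refine (Nat.Prime.coprime_iff_not_dvd hp).mpr fun hdvd => ?_
        exact absurd (Nat.le_of_dvd (by omega) hdvd) (by omega)
    refine hcop.dvd_of_dvd_mul_left ?_
    refine ⟨4 * (2 * k + 1) ^ 2 * u + 4 * (-16) ^ k * ((m + k).choose (2 * k) : ℤ), ?_⟩
    have hp' : (p : ℤ) = 2 * m + 1 := by exact_mod_cast hm
    rw [hp'] at hu ⊢
    rw [show m + (k + 1) = m + k + 1 by ring, show 2 * (k + 1) = 2 * k + 1 + 1 by ring]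
    push_cast at *
    rw [pow_succ]
    linear_combination 2 * (2 * (k : ℤ) + 1) * hC + 4 * (2 * (k : ℤ) + 1) ^ 2 * hu
      + 16 * (-16) ^ k * (2 * (k : ℤ) + 1) * h1 - 16 * (-16) ^ k * ((m : ℤ) - k) * h2

theorem centralBinom_sq_mul_altChooseSum_modEq {p m : ℕ} (hp : p.Prime) (hm : p = 2 * m + 1)
    {k : ℕ} (hk : k < p) :
    (k.centralBinom : ℤ) ^ 2 * ((-4) ^ k * altChooseSum p k) ≡
      (-16) ^ k * ((m + k).choose (2 * k) : ℤ) * k.centralBinom [ZMOD (p : ℤ) ^ 2] := by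
  rcases le_or_gt k m with h | h
  · have hA := four_pow_mul_altChooseSum_modEq hp ⟨m, hm⟩ k (by omega)
    have hA' : (-4) ^ k * altChooseSum p k ≡ 1 [ZMOD (p : ℤ) ^ 2] := by
      have := hA.mul_left ((-1) ^ k)
      rwa [← mul_assoc, ← mul_pow, ← mul_pow, show (-1 * 4 : ℤ) = -4 by norm_num,
        show (-1 * -1 : ℤ) = 1 by norm_num, one_pow] at this
    have hB := (neg_sixteen_pow_mul_choose_modEq hp hm k h).mul_right (k.centralBinom : ℤ)
    have := hA'.mul_left ((k.centralBinom : ℤ) ^ 2)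
    rw [mul_one, sq (k.centralBinom : ℤ)] at this
    rw [sq (k.centralBinom : ℤ)]
    exact this.trans hB.symm
  · have hd : p ∣ k.centralBinom :=
      hp.dvd_choose hk (by omega) (by omega)
    rw [Nat.choose_eq_zero_of_lt (show m + k < 2 * k by omega)]
    simp only [Nat.cast_zero, mul_zero, zero_mul]
    refine (Int.modEq_zero_iff_dvd).mpr (Dvd.dvd.mul_right ?_ _)
    exact pow_dvd_pow_of_dvd (Int.natCast_dvd_natCast.mpr hd) 2

theorem sum_genCentralTrinomial_sq_div {K : Type*} [Field K] [CharZero K] {p : ℕ} (hp : 2 ≤ p) :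
    ∑ n ∈ range p, (genCentralTrinomial 2 (-1) n : K) ^ 2 / (-8) ^ n =
      ∑ k ∈ range p, (k.centralBinom : K) ^ 2 * (-1 / 8) ^ k * (altChooseSum p k : K) := by
  obtain ⟨N, rfl⟩ := Nat.exists_eq_add_of_le' (show 1 ≤ p by omega)
  rw [sum_congr rfl fun n hn => genCentralTrinomial_sq_div (N := N) (by omega)
    (by simp at hn; omega)]
  simp only [clausenSum, altChooseSum, mul_sum, Int.cast_sum]
  rw [sum_comm]
  refine sum_congr rfl fun k _ => sum_congr rfl fun n _ => ?_
  push_cast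
  ring

theorem sum_T2neg1_sq_div_neg_eight_pow_three_mod_four (p : ℕ) [Fact p.Prime]
    (hp3 : p % 4 = 3) :
    ‖∑ k ∈ Finset.range p,
        (genCentralTrinomial 2 (-1) k : ℚ_[p]) ^ 2 / (-8 : ℚ_[p]) ^ k‖ ≤
      (p : ℝ)⁻¹ ^ 2 := by
  have hp : p.Prime := Fact.out
  obtain ⟨j, hj⟩ : ∃ j, p = 2 * (2 * j + 1) + 1 := ⟨p / 4, by omega⟩
  set m := 2 * j + 1 with hm
  set M : ℤ := ∑ k ∈ range p,
    (k.centralBinom : ℤ) ^ 2 * ((-4) ^ k * altChooseSum p k) * 32 ^ (p - k) with hM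
  have hpow : ∀ k ∈ range p, (32 : ℚ_[p]) ^ (p - k) = 32 ^ p / 32 ^ k := fun k hk =>
    pow_sub₀ _ (by norm_num) (mem_range.mp hk).le
  have hMS : (M : ℚ_[p]) = 32 ^ p * ∑ k ∈ range p,
      (genCentralTrinomial 2 (-1) k : ℚ_[p]) ^ 2 / (-8 : ℚ_[p]) ^ k := by
    rw [sum_genCentralTrinomial_sq_div hp.two_le, hM, mul_sum]
    push_cast
    refine sum_congr rfl fun k hk => ?_
    rw [hpow k hk, show (-1 / 8 : ℚ_[p]) = -4 / 32 by norm_num, div_pow]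
    ring
  have hzero : ∑ k ∈ range p, (-16) ^ k * ((m + k).choose (2 * k) : ℤ) * k.centralBinom *
      32 ^ (p - k) = 0 := by
    have h := legendreSum_neg_half_odd (K := ℚ_[p]) (N := p - 1) j (by omega)
    rw [legendreSum, Nat.sub_add_cancel hp.one_le] at h
    have h' : ((∑ k ∈ range p, (-16) ^ k * ((m + k).choose (2 * k) : ℤ) * k.centralBinom *
        32 ^ (p - k) : ℤ) : ℚ_[p]) = 0 := by
      rw [← mul_zero ((32 : ℚ_[p]) ^ p), ← h, mul_sum]
      push_cast
      refine sum_congr rfl fun k hk => ?_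
      rw [hpow k hk, show (-1 / 2 : ℚ_[p]) = -16 / 32 by norm_num, div_pow]
      ring
    exact_mod_cast h'
  have hdvd : (p : ℤ) ^ 2 ∣ M := by
    rw [← Int.modEq_zero_iff_dvd, ← hzero]
    exact Int.ModEq.sum fun k hk =>
      (centralBinom_sq_mul_altChooseSum_modEq hp hj (mem_range.mp hk)).mul_right _
  have hnorm : ‖(32 : ℚ_[p])‖ = 1 := by
    have : ‖((32 : ℕ) : ℚ_[p])‖ = 1 := by
      rw [Padic.norm_natCast_eq_one_iff]
      have h2 : p.Coprime 2 := (Nat.coprime_primes hp Nat.prime_two).mpr (by omega)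
      exact h2.pow_right 5
    simpa using this
  have hle := (Padic.norm_int_le_pow_iff_dvd M 2).mpr (by exact_mod_cast hdvd)
  rw [hMS, norm_mul, norm_pow, hnorm, one_pow, one_mul] at hle
  simpa [zpow_neg] using hle
end

section
/- For all integers b, c, with d = b^2 - 4c, and every n ∈ ℕ, one has the identity T_n(b,c)^2 = ∑_{k=0}^{n} binom(n+k,2k) · binom(2k,k)^2 · c^k · d^{n-k}. -/
theorem mul_pow_tsub_add {R : Type*} [CommRing R] (x d : R) (n m j : ℕ)
    (h : n < m → x = 0) : d ^ j * (x * d ^ (n - m)) = x * d ^ (n + j - m) := by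
  by_cases hnm : n < m
  · simp [h hnm]
  · rw [show n + j - m = j + (n - m) by omega, pow_add]
    ring

theorem Int.choose_succ_mul_sub (n k : ℕ) :
    ((n + 1).choose k : ℤ) * (n + 1 - k) = (n + 1) * n.choose k := by
  rcases le_or_gt k (n + 1) with h | h
  · have := Nat.choose_mul_succ_eq n k
    zify [h] at this
    linarith
  · simp [Nat.choose_eq_zero_of_lt h, Nat.choose_eq_zero_of_lt (show n < k by omega)]

theorem Int.choose_succ_right_mul (n k : ℕ) :
    (n.choose (k + 1) : ℤ) * (k + 1) = n.choose k * (n - k) := by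
  rcases le_or_gt k n with h | h
  · have := Nat.choose_succ_right_eq n k
    zify [h] at this
    exact this
  · simp [Nat.choose_eq_zero_of_lt h, Nat.choose_eq_zero_of_lt (show n < k + 1 by omega)]

theorem Int.centralBinom_succ_mul (k : ℕ) :
    ((2 * (k + 1)).choose (k + 1) : ℤ) * (k + 1) = 2 * (2 * k + 1) * (2 * k).choose k := by
  have := Nat.succ_mul_centralBinom_succ k
  simp only [Nat.centralBinom] at this
  zify at this
  linarith

/-- The coefficient of `b ^ (n - 2 * k) * c ^ k` in `genCentralTrinomial b c n`. -/
def trinomialCoeff (n k : ℕ) : ℤ := (n.choose (2 * k) : ℤ) * ((2 * k).choose k : ℤ)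

theorem trinomialCoeff_eq_zero {n k : ℕ} (h : n < 2 * k) : trinomialCoeff n k = 0 := by
  simp [trinomialCoeff, Nat.choose_eq_zero_of_lt h]

theorem trinomialCoeff_succ_left (n k : ℕ) :
    (n + 1 - 2 * k) * trinomialCoeff (n + 1) k = (n + 1) * trinomialCoeff n k := by
  have h := Int.choose_succ_mul_sub n (2 * k)
  push_cast at h
  simp only [trinomialCoeff]
  linear_combination ((2 * k).choose k : ℤ) * h

theorem trinomialCoeff_succ_right (n k : ℕ) :
    (k + 1 : ℤ) ^ 2 * trinomialCoeff n (k + 1) =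
      (n - 2 * k) * (n - 2 * k - 1) * trinomialCoeff n k := by
  have h₁ := Int.choose_succ_right_mul n (2 * k)
  have h₂ := Int.choose_succ_right_mul n (2 * k + 1)
  have h₃ := Int.centralBinom_succ_mul k
  have h₀ : (2 * (2 * k + 1) : ℤ) ≠ 0 := by positivity
  simp only [trinomialCoeff, show 2 * (k + 1) = 2 * k + 1 + 1 by ring] at *
  push_cast at *
  apply mul_left_cancel₀ h₀
  linear_combination (2 * (2 * k + 1) * (k + 1) * (n.choose (2 * k + 1 + 1) : ℤ)) * h₃ +
    (2 * (2 * k + 1) ^ 2 * ((2 * k).choose k : ℤ)) * h₂ +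
    (2 * (2 * k + 1) * ((2 * k).choose k : ℤ) * (n - 2 * k - 1)) * h₁

theorem trinomialCoeff_recurrence (n k : ℕ) :
    (n + 2) * trinomialCoeff (n + 2) (k + 1) =
      (2 * n + 3) * trinomialCoeff (n + 1) (k + 1) - (n + 1) * trinomialCoeff n (k + 1) +
        4 * (n + 1) * trinomialCoeff n k := by
  have h₀ : (k + 1 : ℤ) ^ 2 ≠ 0 := by positivity
  have r₀ := trinomialCoeff_succ_right n k
  have r₁ := trinomialCoeff_succ_right (n + 1) k
  have r₂ := trinomialCoeff_succ_right (n + 2) k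
  have l₀ := trinomialCoeff_succ_left n k
  have l₁ := trinomialCoeff_succ_left (n + 1) k
  push_cast at *
  apply mul_left_cancel₀ h₀
  linear_combination (n + 2 : ℤ) * r₂ - (2 * n + 3 : ℤ) * r₁ + (n + 1 : ℤ) * r₀ +
    (n + 2 : ℤ) * (n + 1 - 2 * k) * l₁ + ((n + 2 : ℤ) ^ 2 - (2 * n + 3) * (n - 2 * k)) * l₀

theorem genCentralTrinomial_eq_sum_range (b c : ℤ) {n M : ℕ} (h : n < M) :
    genCentralTrinomial b c n =
      ∑ k ∈ Finset.range M, trinomialCoeff n k * b ^ (n - 2 * k) * c ^ k := by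
  refine Finset.sum_subset (fun x hx => ?_) fun x _ hx => ?_
  · simp only [Finset.mem_range] at *
    omega
  · simp only [Finset.mem_range] at hx
    simp [Nat.choose_eq_zero_of_lt (show n < 2 * x by omega)]

theorem genCentralTrinomial_recurrence (b c : ℤ) (n : ℕ) :
    (n + 2) * genCentralTrinomial b c (n + 2) =
      (2 * n + 3) * b * genCentralTrinomial b c (n + 1) -
        (n + 1) * (b ^ 2 - 4 * c) * genCentralTrinomial b c n := by
  have e₀ := genCentralTrinomial_eq_sum_range b c (show n < n + 3 by omega)
  have e₀' := genCentralTrinomial_eq_sum_range b c (show n < n + 3 + 1 by omega)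
  have e₁ := genCentralTrinomial_eq_sum_range b c (show n + 1 < n + 3 + 1 by omega)
  have e₂ := genCentralTrinomial_eq_sum_range b c (show n + 2 < n + 3 + 1 by omega)
  rw [Finset.sum_range_succ'] at e₀' e₁ e₂
  have key : ∀ k ∈ Finset.range (n + 3),
      (n + 2) * (trinomialCoeff (n + 2) (k + 1) * b ^ (n + 2 - 2 * (k + 1)) * c ^ (k + 1)) =
        (2 * n + 3) * b *
            (trinomialCoeff (n + 1) (k + 1) * b ^ (n + 1 - 2 * (k + 1)) * c ^ (k + 1)) -
          (n + 1) * b ^ 2 * (trinomialCoeff n (k + 1) * b ^ (n - 2 * (k + 1)) * c ^ (k + 1)) +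
          4 * (n + 1) * c * (trinomialCoeff n k * b ^ (n - 2 * k) * c ^ k) := by
    intro k _
    have p₁ := mul_pow_tsub_add (trinomialCoeff (n + 1) (k + 1)) b (n + 1) (2 * (k + 1)) 1
      trinomialCoeff_eq_zero
    have p₀ := mul_pow_tsub_add (trinomialCoeff n (k + 1)) b n (2 * (k + 1)) 2
      trinomialCoeff_eq_zero
    rw [show n + 1 + 1 - 2 * (k + 1) = n - 2 * k by omega] at p₁
    rw [show n + 2 - 2 * (k + 1) = n - 2 * k by omega] at p₀ ⊢
    linear_combination c ^ (k + 1) * b ^ (n - 2 * k) * trinomialCoeff_recurrence n k -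
      (2 * n + 3) * c ^ (k + 1) * p₁ + (n + 1) * c ^ (k + 1) * p₀
  have key := Finset.sum_congr rfl key
  simp only [Finset.sum_add_distrib, Finset.sum_sub_distrib, ← Finset.mul_sum] at key
  have z : ∀ m, trinomialCoeff m 0 = 1 := fun m => by simp [trinomialCoeff]
  simp only [z, mul_zero, Nat.sub_zero, pow_zero] at e₀' e₁ e₂
  linear_combination key + (n + 2 : ℤ) * e₂ - (2 * n + 3) * b * e₁ + (n + 1) * b ^ 2 * e₀' -
    4 * (n + 1) * c * e₀

/-- The coefficient of `c ^ k * d ^ (n - k)` in the expansion of the square of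
`genCentralTrinomial b c n`, where `d = b ^ 2 - 4 * c`. -/
def trinomialSqCoeff (n k : ℕ) : ℤ :=
  ((n + k).choose (2 * k) : ℤ) * ((2 * k).choose k : ℤ) ^ 2

theorem trinomialSqCoeff_eq_zero {n k : ℕ} (h : n < k) : trinomialSqCoeff n k = 0 := by
  simp [trinomialSqCoeff, Nat.choose_eq_zero_of_lt (show n + k < 2 * k by omega)]

theorem trinomialSqCoeff_succ_left (n k : ℕ) :
    (n + 1 - k) * trinomialSqCoeff (n + 1) k = (n + 1 + k) * trinomialSqCoeff n k := by
  have h := Int.choose_succ_mul_sub (n + k) (2 * k)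
  push_cast at h
  simp only [trinomialSqCoeff, show n + 1 + k = n + k + 1 by ring]
  linear_combination ((2 * k).choose k : ℤ) ^ 2 * h

theorem trinomialSqCoeff_succ_right (n k : ℕ) :
    (k + 1 : ℤ) ^ 3 * trinomialSqCoeff n (k + 1) =
      2 * (2 * k + 1) * (n + k + 1) * (n - k) * trinomialSqCoeff n k := by
  have h₁ := Int.choose_succ_right_mul (n + k) (2 * k)
  have h₂ : ((n + k + 1).choose (2 * k + 1 + 1) : ℤ) * (2 * k + 2) =
      (n + k + 1) * (n + k).choose (2 * k + 1) := by
    have := Nat.add_one_mul_choose_eq (n + k) (2 * k + 1)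
    zify at this
    linarith
  have h₃ := Int.centralBinom_succ_mul k
  have h₀ : (2 * k + 1 : ℤ) ≠ 0 := by positivity
  simp only [trinomialSqCoeff, show 2 * (k + 1) = 2 * k + 1 + 1 by ring, ← add_assoc] at *
  push_cast at *
  apply mul_left_cancel₀ h₀
  generalize ((n + k + 1).choose (2 * k + 1 + 1) : ℤ) = u at *
  generalize ((n + k).choose (2 * k + 1) : ℤ) = v at *
  generalize ((n + k).choose (2 * k) : ℤ) = w at *
  generalize ((2 * k + 1 + 1).choose (k + 1) : ℤ) = x at *
  generalize ((2 * k).choose k : ℤ) = y at *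
  linear_combination (2 * k + 1) * (k + 1) * u * (x * (k + 1) + 2 * (2 * k + 1) * y) * h₃ +
    2 * (2 * k + 1) ^ 3 * y ^ 2 * h₂ + 2 * (2 * k + 1) ^ 2 * y ^ 2 * (n + k + 1) * h₁

theorem trinomialSqCoeff_recurrence (n k : ℕ) :
    (n + 2) ^ 2 * trinomialSqCoeff (n + 2) (k + 1) =
      (2 * n + 3) * ((2 * k + 3) * trinomialSqCoeff (n + 1) (k + 1) +
        4 * (2 * k + 1) * trinomialSqCoeff (n + 1) k) +
        (n + 1) ^ 2 * trinomialSqCoeff n (k + 1) := by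
  have h₀ : (k + 1 : ℤ) ^ 3 ≠ 0 := by positivity
  have r₀ := trinomialSqCoeff_succ_right n k
  have r₁ := trinomialSqCoeff_succ_right (n + 1) k
  have r₂ := trinomialSqCoeff_succ_right (n + 2) k
  have l₀ := trinomialSqCoeff_succ_left n k
  have l₁ := trinomialSqCoeff_succ_left (n + 1) k
  push_cast at *
  apply mul_left_cancel₀ h₀
  linear_combination (n + 2 : ℤ) ^ 2 * r₂ - (2 * n + 3 : ℤ) * (2 * k + 3) * r₁ -
    (n + 1 : ℤ) ^ 2 * r₀ + 2 * (2 * k + 1) * (n + k + 3) * (n + 2 : ℤ) ^ 2 * l₁ +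
    2 * (2 * k + 1) * (n + 1 : ℤ) ^ 2 * (n - k) * l₀

/-- The `k`-th term in the expansion of the square of `genCentralTrinomial b c n`
in powers of `c` and `d = b ^ 2 - 4 * c`. -/
def trinomialSqTerm (c d : ℤ) (n k : ℕ) : ℤ := trinomialSqCoeff n k * c ^ k * d ^ (n - k)

theorem trinomialSqTerm_eq_zero (c d : ℤ) {n k : ℕ} (h : n < k) :
    trinomialSqTerm c d n k = 0 := by
  simp [trinomialSqTerm, trinomialSqCoeff_eq_zero h]

theorem trinomialSqTerm_succ_left (c d : ℤ) (n k : ℕ) :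
    (n + 1 - k) * trinomialSqTerm c d (n + 1) k =
      d * ((n + 1 + k) * trinomialSqTerm c d n k) := by
  have p := mul_pow_tsub_add (trinomialSqCoeff n k) d n k 1 trinomialSqCoeff_eq_zero
  simp only [trinomialSqTerm]
  linear_combination c ^ k * d ^ (n + 1 - k) * trinomialSqCoeff_succ_left n k -
    (n + 1 + k) * c ^ k * p

theorem trinomialSqTerm_recurrence (c d : ℤ) (n k : ℕ) :
    (n + 2) ^ 2 * trinomialSqTerm c d (n + 2) (k + 1) =
      (2 * n + 3) * (d * ((2 * k + 3) * trinomialSqTerm c d (n + 1) (k + 1)) +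
        4 * c * ((2 * k + 1) * trinomialSqTerm c d (n + 1) k)) +
        (n + 1) ^ 2 * d ^ 2 * trinomialSqTerm c d n (k + 1) := by
  have p₁ := mul_pow_tsub_add (trinomialSqCoeff (n + 1) (k + 1)) d (n + 1) (k + 1) 1
    trinomialSqCoeff_eq_zero
  have p₀ := mul_pow_tsub_add (trinomialSqCoeff n (k + 1)) d n (k + 1) 2
    trinomialSqCoeff_eq_zero
  simp only [trinomialSqTerm]
  rw [show n + 1 + 1 - (k + 1) = n + 1 - k by omega] at p₁
  rw [show n + 2 - (k + 1) = n + 1 - k by omega] at p₀ ⊢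
  linear_combination c ^ (k + 1) * d ^ (n + 1 - k) * trinomialSqCoeff_recurrence n k -
    (2 * n + 3) * (2 * k + 3) * c ^ (k + 1) * p₁ - (n + 1) ^ 2 * c ^ (k + 1) * p₀

/-- The expansion of the square of `genCentralTrinomial b c n` in `c` and `d = b ^ 2 - 4 * c`. -/
def trinomialSqSum (c d : ℤ) (n : ℕ) : ℤ :=
  ∑ k ∈ Finset.range (n + 1), trinomialSqTerm c d n k

/-- The image of `trinomialSqSum c d n` under the Euler operator `d * ∂/∂d`. -/
def trinomialSqEulerSum (c d : ℤ) (n : ℕ) : ℤ :=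
  ∑ k ∈ Finset.range (n + 1), (n - k) * trinomialSqTerm c d n k

theorem trinomialSqSum_eq_sum_range (c d : ℤ) {n M : ℕ} (h : n < M) :
    trinomialSqSum c d n = ∑ k ∈ Finset.range M, trinomialSqTerm c d n k := by
  refine Finset.sum_subset (by simpa using h) fun k _ hk => trinomialSqTerm_eq_zero c d ?_
  simpa using hk

theorem trinomialSqEulerSum_eq_sum_range (c d : ℤ) {n M : ℕ} (h : n < M) :
    trinomialSqEulerSum c d n = ∑ k ∈ Finset.range M, (n - k) * trinomialSqTerm c d n k := by
  refine Finset.sum_subset (by simpa using h) fun k _ hk => ?_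
  rw [trinomialSqTerm_eq_zero c d (by simpa using hk), mul_zero]

theorem trinomialSqEulerSum_succ (c d : ℤ) (n : ℕ) :
    trinomialSqEulerSum c d (n + 1) =
      d * ((2 * n + 1) * trinomialSqSum c d n - trinomialSqEulerSum c d n) := by
  rw [trinomialSqSum_eq_sum_range c d (show n < n + 2 by omega),
    trinomialSqEulerSum_eq_sum_range c d (show n < n + 2 by omega),
    trinomialSqEulerSum, Finset.mul_sum, ← Finset.sum_sub_distrib, Finset.mul_sum]
  refine Finset.sum_congr rfl fun k _ => ?_
  push_cast
  linear_combination trinomialSqTerm_succ_left c d n k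

theorem two_mul_add_one_mul_trinomialSqSum_sub (c d : ℤ) {n M : ℕ} (h : n < M) :
    (2 * n + 1) * trinomialSqSum c d n - 2 * trinomialSqEulerSum c d n =
      ∑ k ∈ Finset.range M, (2 * k + 1) * trinomialSqTerm c d n k := by
  rw [trinomialSqSum_eq_sum_range c d h, trinomialSqEulerSum_eq_sum_range c d h,
    Finset.mul_sum, Finset.mul_sum, ← Finset.sum_sub_distrib]
  exact Finset.sum_congr rfl fun k _ => by ring

theorem trinomialSqSum_recurrence (c d : ℤ) (n : ℕ) :
    (n + 2) ^ 2 * trinomialSqSum c d (n + 2) =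
      (2 * n + 3) * (d + 4 * c) * ((2 * n + 3) * trinomialSqSum c d (n + 1) -
        2 * trinomialSqEulerSum c d (n + 1)) + (n + 1) ^ 2 * d ^ 2 * trinomialSqSum c d n := by
  have e₀ := trinomialSqSum_eq_sum_range c d (show n < n + 3 + 1 by omega)
  have e₁ := two_mul_add_one_mul_trinomialSqSum_sub c d (show n + 1 < n + 3 by omega)
  have e₁' := two_mul_add_one_mul_trinomialSqSum_sub c d (show n + 1 < n + 3 + 1 by omega)
  have e₂ := trinomialSqSum_eq_sum_range c d (show n + 2 < n + 3 + 1 by omega)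
  rw [Finset.sum_range_succ'] at e₀ e₁' e₂
  have key := Finset.sum_congr (rfl : Finset.range (n + 3) = _)
    fun k _ => trinomialSqTerm_recurrence c d n k
  simp only [Finset.sum_add_distrib, ← Finset.mul_sum] at key
  have z : ∀ m, trinomialSqTerm c d m 0 = d ^ m := fun m => by
    simp [trinomialSqTerm, trinomialSqCoeff]
  have s : ∀ k : ℕ, (2 * ((k : ℤ) + 1) + 1) = 2 * k + 3 := fun k => by ring
  push_cast at e₁ e₁'
  simp only [z, s] at e₀ e₁' e₂
  linear_combination key + (n + 2 : ℤ) ^ 2 * e₂ - (2 * n + 3) * d * e₁' -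
    (2 * n + 3) * 4 * c * e₁ - (n + 1) ^ 2 * d ^ 2 * e₀

theorem genCentralTrinomial_sq_eq_trinomialSqSum (b c d : ℤ) (hd : d = b ^ 2 - 4 * c) (n : ℕ) :
    genCentralTrinomial b c n ^ 2 = trinomialSqSum c d n ∧
      genCentralTrinomial b c (n + 1) ^ 2 = trinomialSqSum c d (n + 1) ∧
      (n + 1) * d * (genCentralTrinomial b c (n + 1) * genCentralTrinomial b c n) =
        b * trinomialSqEulerSum c d (n + 1) := by
  induction n with
  | zero =>
    simp [genCentralTrinomial, trinomialSqSum, trinomialSqEulerSum, trinomialSqTerm,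
      trinomialSqCoeff, Finset.sum_range_succ, hd]
    ring
  | succ n ih =>
    obtain ⟨h₀, h₁, hB⟩ := ih
    have hT := genCentralTrinomial_recurrence b c n
    have hS := trinomialSqSum_recurrence c d n
    have hE := trinomialSqEulerSum_succ c d (n + 1)
    rw [← hd] at hT
    simp only [add_assoc, one_add_one_eq_two] at *
    push_cast at *
    generalize genCentralTrinomial b c (n + 2) = t₂ at *
    generalize genCentralTrinomial b c (n + 1) = t₁ at *
    generalize genCentralTrinomial b c n = t₀ at *
    refine ⟨h₁, ?_, ?_⟩
    · have h : (n + 2 : ℤ) ^ 2 ≠ 0 := by positivity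
      apply mul_left_cancel₀ h
      have hb : d + 4 * c = b ^ 2 := by rw [hd]; ring
      rw [hS, hb, ← h₀, ← h₁]
      linear_combination ((n + 2) * t₂ + (2 * n + 3) * b * t₁ - (n + 1) * d * t₀) * hT -
        2 * (2 * n + 3) * b * hB
    · rw [hE, ← h₁]
      linear_combination d * t₁ * hT - d * hB

theorem genCentralTrinomial_sq (b c d : ℤ) (hd : d = b ^ 2 - 4 * c) (n : ℕ) :
    (genCentralTrinomial b c n) ^ 2 =
      ∑ k ∈ Finset.range (n + 1),
        ((n + k).choose (2 * k) : ℤ) * ((2 * k).choose k : ℤ) ^ 2 *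
          c ^ k * d ^ (n - k) := by
  exact (genCentralTrinomial_sq_eq_trinomialSqSum b c d hd n).1
end

section
/- For every nonnegative integer n and every real number x (equivalently, as an identity of polynomials in x over ℚ), ∑_{k=0}^{n} binom(n,k)·H_k·x^k = (1+x)^n·H_n − ∑_{k=1}^{n} (1+x)^{n-k}/k, where H_j = ∑_{i=1}^{j} 1/i is the j-th harmonic number (H_0 = 0). -/
/-- The `n`-th harmonic number `H_n = ∑_{k=1}^n 1/k` (with `H_0 = 0`), as a real number. -/
noncomputable def harmonicNum (n : ℕ) : ℝ :=
  ∑ k ∈ Finset.Icc 1 n, (1 : ℝ) / k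

theorem harmonicNum_succ (n : ℕ) : harmonicNum (n + 1) = harmonicNum n + 1 / ((n : ℝ) + 1) := by
  rw [harmonicNum, harmonicNum, Finset.sum_Icc_succ_top (by omega)]
  push_cast
  rfl

theorem sum_choose_div_succ_mul_pow (n : ℕ) (x : ℝ) :
    ∑ k ∈ Finset.range (n + 1), (n.choose k : ℝ) * (1 / ((k : ℝ) + 1) * x ^ (k + 1)) =
      ((1 + x) ^ (n + 1) - 1) / ((n : ℝ) + 1) := by
  rw [add_comm 1 x, add_pow, Finset.sum_range_succ' _ (n + 1), eq_div_iff (by positivity), Finset.sum_mul]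
  simp only [one_pow, mul_one, pow_zero, Nat.choose_zero_right, Nat.cast_one, add_sub_cancel_right]
  refine Finset.sum_congr rfl fun k _ => ?_
  have h : ((n : ℝ) + 1) * n.choose k = (n + 1).choose (k + 1) * ((k : ℝ) + 1) := by
    exact_mod_cast Nat.add_one_mul_choose_eq n k
  have hk : (k : ℝ) + 1 ≠ 0 := by positivity
  field_simp
  linear_combination x ^ (k + 1) * h

theorem sum_choose_succ_harmonic (n : ℕ) (x : ℝ) :
    ∑ k ∈ Finset.range (n + 2), ((n + 1).choose k : ℝ) * harmonicNum k * x ^ k =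
      (1 + x) * ∑ k ∈ Finset.range (n + 1), (n.choose k : ℝ) * harmonicNum k * x ^ k +
        ((1 + x) ^ (n + 1) - 1) / ((n : ℝ) + 1) := by
  simp only [mul_assoc]
  rw [Finset.sum_choose_succ_mul (fun k _ => harmonicNum k * x ^ k), add_mul, one_mul, add_assoc,
    ← sum_choose_div_succ_mul_pow, add_right_inj, Finset.mul_sum, ← Finset.sum_add_distrib]
  refine Finset.sum_congr rfl fun k _ => ?_
  rw [harmonicNum_succ]
  ring

theorem sum_pow_sub_div_succ (n : ℕ) (y : ℝ) :
    ∑ k ∈ Finset.Icc 1 (n + 1), y ^ (n + 1 - k) / (k : ℝ) =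
      y * ∑ k ∈ Finset.Icc 1 n, y ^ (n - k) / (k : ℝ) + 1 / ((n : ℝ) + 1) := by
  rw [Finset.sum_Icc_succ_top (by omega), Finset.mul_sum, Nat.sub_self, pow_zero]
  push_cast
  congr 1
  refine Finset.sum_congr rfl fun k hk => ?_
  rw [Nat.succ_sub (Finset.mem_Icc.mp hk).2, pow_succ]
  ring

theorem sum_choose_harmonic (n : ℕ) (x : ℝ) :
    ∑ k ∈ Finset.range (n + 1), (n.choose k : ℝ) * harmonicNum k * x ^ k =
      (1 + x) ^ n * harmonicNum n -
        ∑ k ∈ Finset.Icc 1 n, (1 + x) ^ (n - k) / (k : ℝ) := by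
  induction n with
  | zero => simp [harmonicNum]
  | succ n ih =>
    rw [sum_choose_succ_harmonic, ih, sum_pow_sub_div_succ, harmonicNum_succ]
    ring
end

section
/- For every positive integer n and every real number x ≠ -1, ∑_{k=0}^{n-1} x^k / binom(2n-1,k) = (2n/(x+1)) · ∑_{k=1}^{2n} (1/k)·(x/(x+1))^{2n-k} + (2n(x-1)/(x+1)^2) · ∑_{k=1}^{n} (x^k/(k·binom(2k,k)))·(x/(x+1))^{2n-2k}. -/
open scoped Nat in
/-- The Beta value `B(k + 1, m - k) = 1 / (m * (m - 1).choose k)`, for `k < m`. -/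
noncomputable def betaCoeff (m k : ℕ) : ℝ := (k ! * (m - 1 - k)! : ℝ) / m !

lemma betaCoeff_eq_inv_choose {m k : ℕ} (h : k < m) :
    betaCoeff m k = 1 / (m * ((m - 1).choose k : ℝ)) := by
  obtain ⟨m, rfl⟩ : ∃ j, m = j + 1 := ⟨m - 1, by omega⟩
  have hk : k ≤ m := by omega
  simp only [betaCoeff, Nat.add_sub_cancel]
  rw [Nat.cast_choose ℝ hk, Nat.factorial_succ]
  have := Nat.factorial_ne_zero m
  have := Nat.factorial_ne_zero k
  have := Nat.factorial_ne_zero (m - k)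
  push_cast
  field_simp

lemma betaCoeff_succ_zero (m : ℕ) : betaCoeff (m + 1) 0 = 1 / (m + 1) := by
  rw [betaCoeff_eq_inv_choose (by omega)]
  simp

lemma betaCoeff_add {m k : ℕ} (h : k < m) :
    betaCoeff (m + 1) k + betaCoeff (m + 1) (k + 1) = betaCoeff m k := by
  obtain ⟨j, rfl⟩ : ∃ j, m = k + j + 1 := ⟨m - k - 1, by omega⟩
  have h1 : k + j + 1 + 1 - 1 - k = j + 1 := by omega
  have h2 : k + j + 1 + 1 - 1 - (k + 1) = j := by omega
  have h3 : k + j + 1 - 1 - k = j := by omega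
  simp only [betaCoeff, h1, h2, h3]
  rw [Nat.factorial_succ (k + j + 1), Nat.factorial_succ k, Nat.factorial_succ j]
  have := Nat.factorial_ne_zero (k + j + 1)
  push_cast
  field_simp
  ring

lemma betaCoeff_middle (n : ℕ) :
    betaCoeff (2 * n + 1) n = 2 * betaCoeff (2 * n + 2) (n + 1) := by
  have h1 : 2 * n + 1 - 1 - n = n := by omega
  have h2 : 2 * n + 2 - 1 - (n + 1) = n := by omega
  simp only [betaCoeff, h1, h2]
  rw [Nat.factorial_succ (2 * n + 1), Nat.factorial_succ n]
  have := Nat.factorial_ne_zero (2 * n + 1)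
  push_cast
  field_simp
  ring

lemma betaCoeff_two_mul (n : ℕ) :
    betaCoeff (2 * n + 2) (n + 1) =
      1 / ((n + 1 : ℕ) * ((2 * n + 2).choose (n + 1) : ℝ)) := by
  have h2 : 2 * n + 2 - 1 - (n + 1) = n := by omega
  have h3 : 2 * n + 2 - (n + 1) = n + 1 := by omega
  rw [Nat.cast_choose ℝ (by omega : n + 1 ≤ 2 * n + 2)]
  simp only [betaCoeff, h2, h3]
  rw [Nat.factorial_succ n]
  have := Nat.factorial_ne_zero (2 * n + 2)
  have := Nat.factorial_ne_zero n
  push_cast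
  field_simp

lemma add_one_mul_sum_betaCoeff (x : ℝ) {m N : ℕ} (h : N ≤ m) :
    (x + 1) * ∑ k ∈ Finset.range N, x ^ k * betaCoeff (m + 1) k =
      x * ∑ k ∈ Finset.range N, x ^ k * betaCoeff m k + 1 / (m + 1) -
        x ^ N * betaCoeff (m + 1) N := by
  induction N with
  | zero => simp [betaCoeff_succ_zero]
  | succ N ih =>
    rw [Finset.sum_range_succ, Finset.sum_range_succ, mul_add, ih (by omega),
      ← betaCoeff_add (show N < m by omega)]
    ring

lemma sq_add_one_mul_sum_betaCoeff (x : ℝ) (n : ℕ) :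
    (x + 1) ^ 2 * ∑ k ∈ Finset.range (n + 1), x ^ k * betaCoeff (2 * n + 2) k =
      x ^ 2 * ∑ k ∈ Finset.range n, x ^ k * betaCoeff (2 * n) k + x / (2 * n + 1) +
        (x + 1) / (2 * n + 2) + (x - 1) * (x ^ (n + 1) * betaCoeff (2 * n + 2) (n + 1)) := by
  have h1 := add_one_mul_sum_betaCoeff x (show n + 1 ≤ 2 * n + 1 by omega)
  have h2 := add_one_mul_sum_betaCoeff x (show n ≤ 2 * n by omega)
  rw [Finset.sum_range_succ (fun k => x ^ k * betaCoeff (2 * n + 1) k)] at h1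
  have h3 := betaCoeff_middle n
  push_cast at h1 h2
  have h4 : (2 * n + 1 + 1 : ℝ) = 2 * n + 2 := by ring
  rw [h4] at h1
  rw [h3] at h1 h2
  linear_combination (x + 1) * h1 + x * h2

lemma sum_Icc_mul_pow_add {R : Type*} [CommSemiring R] (f : ℕ → R) (a : R) (c m d : ℕ) :
    ∑ k ∈ Finset.Icc 1 m, f k * a ^ (c * m + d - c * k) =
      a ^ d * ∑ k ∈ Finset.Icc 1 m, f k * a ^ (c * m - c * k) := by
  rw [Finset.mul_sum]
  refine Finset.sum_congr rfl fun k hk => ?_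
  have hk := Nat.mul_le_mul_left c (Finset.mem_Icc.mp hk).2
  rw [show c * m + d - c * k = d + (c * m - c * k) by omega, pow_add]
  ring

lemma sum_betaCoeff_eq (x : ℝ) (hx : x + 1 ≠ 0) (n : ℕ) :
    ∑ k ∈ Finset.range n, x ^ k * betaCoeff (2 * n) k =
      (1 / (x + 1)) *
        ∑ k ∈ Finset.Icc 1 (2 * n), (1 / (k : ℝ)) * (x / (x + 1)) ^ (2 * n - k) +
      ((x - 1) / (x + 1) ^ 2) *
        ∑ k ∈ Finset.Icc 1 n,
          (x ^ k / ((k : ℝ) * ((2 * k).choose k : ℝ))) * (x / (x + 1)) ^ (2 * n - 2 * k) := by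
  induction n with
  | zero => simp
  | succ n ih =>
    have h1 := sum_Icc_mul_pow_add (fun k => 1 / (k : ℝ)) (x / (x + 1)) 1 (2 * n) 2
    have h2 := sum_Icc_mul_pow_add
      (fun k => x ^ k / ((k : ℝ) * ((2 * k).choose k : ℝ))) (x / (x + 1)) 2 n 2
    simp only [one_mul] at h1
    have hs := sq_add_one_mul_sum_betaCoeff x n
    rw [ih] at hs
    rw [Finset.sum_Icc_succ_top (by omega : 1 ≤ n + 1), show 2 * (n + 1) = 2 * n + 2 by ring,
      Finset.sum_Icc_succ_top (by omega : 1 ≤ 2 * n + 1 + 1),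
      Finset.sum_Icc_succ_top (by omega : 1 ≤ 2 * n + 1), h1, h2,
      show 2 * n + 2 - (2 * n + 1) = 1 by omega, show 2 * n + 2 - (2 * n + 1 + 1) = 0 by omega,
      div_eq_mul_one_div (x ^ (n + 1)), ← betaCoeff_two_mul]
    apply mul_left_cancel₀ (pow_ne_zero 2 hx)
    rw [hs]
    have h4 : (2 * n + 1 + 1 : ℝ) = 2 * n + 2 := by ring
    push_cast
    rw [h4]
    field_simp
    ring

theorem sum_inv_choose_identity (n : ℕ) (hn : 0 < n) (x : ℝ) (hx : x ≠ -1) :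
    ∑ k ∈ Finset.range n, x ^ k / ((2 * n - 1).choose k : ℝ) =
      (2 * n / (x + 1)) *
        ∑ k ∈ Finset.Icc 1 (2 * n), (1 / (k : ℝ)) * (x / (x + 1)) ^ (2 * n - k) +
      (2 * n * (x - 1) / (x + 1) ^ 2) *
        ∑ k ∈ Finset.Icc 1 n,
          (x ^ k / ((k : ℝ) * ((2 * k).choose k : ℝ))) * (x / (x + 1)) ^ (2 * n - 2 * k) := by
  have hx' : x + 1 ≠ 0 := fun h => hx (eq_neg_of_add_eq_zero_left h)
  have hsum : ∑ k ∈ Finset.range n, x ^ k / ((2 * n - 1).choose k : ℝ) =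
      2 * n * ∑ k ∈ Finset.range n, x ^ k * betaCoeff (2 * n) k := by
    rw [Finset.mul_sum]
    refine Finset.sum_congr rfl fun k hk => ?_
    have hk := Finset.mem_range.mp hk
    rw [betaCoeff_eq_inv_choose (by omega)]
    have := (Nat.choose_pos (show k ≤ 2 * n - 1 by omega)).ne'
    push_cast
    field_simp
  rw [hsum, sum_betaCoeff_eq x hx' n]
  ring
end

section
/- For every positive integer n and every real number x ≠ -1, ∑_{k=0}^{n-1} x^k / binom(2n-1,k) = (n/(x+1)^2) · ∑_{k=1}^{n} (((4k-1)x + 2k-1)/(k(2k-1))) · (x/(x+1))^{2n-2k} + (2n(x-1)/(x+1)^2) · ∑_{k=1}^{n} (x^k/(k·binom(2k,k))) · (x/(x+1))^{2n-2k}. -/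
/-- Pascal-type recurrence for the reciprocals `1 / ((m + 1) * m.choose k)`. -/
lemma inv_succ_mul_choose_eq_add {m k : ℕ} (hk : k ≤ m) :
    (1 : ℝ) / ((m + 1) * (m.choose k : ℝ)) =
      1 / ((m + 2) * ((m + 1).choose k : ℝ)) + 1 / ((m + 2) * ((m + 1).choose (k + 1) : ℝ)) := by
  have h1 : ((m + 1 : ℕ) : ℝ) * (m.choose k : ℝ) =
      ((m + 1).choose (k + 1) : ℝ) * ((k + 1 : ℕ) : ℝ) :=
    mod_cast Nat.add_one_mul_choose_eq m k
  have h2 : (m.choose k : ℝ) * (m + 1) = ((m + 1).choose k : ℝ) * (m + 1 - k) := by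
    have h := Nat.choose_mul_succ_eq m k
    rw [← @Nat.cast_inj ℝ] at h
    push_cast [Nat.cast_sub (show k ≤ m + 1 by omega)] at h
    exact h
  have c0 : (m.choose k : ℝ) ≠ 0 := mod_cast (Nat.choose_pos hk).ne'
  have hkm : (k : ℝ) ≤ m := mod_cast hk
  have d1 : (k : ℝ) + 1 ≠ 0 := by positivity
  have d2 : (m : ℝ) + 1 - k ≠ 0 := by linarith
  have e1 : ((m + 1).choose (k + 1) : ℝ) = (m + 1) * m.choose k / (k + 1) := by
    rw [eq_div_iff d1]; push_cast at h1; exact h1.symm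
  have e2 : ((m + 1).choose k : ℝ) = (m + 1) * m.choose k / (m + 1 - k) := by
    rw [eq_div_iff d2]; linarith
  have d3 : (m : ℝ) + 1 ≠ 0 := by positivity
  have d4 : (m : ℝ) + 2 ≠ 0 := by positivity
  rw [e1, e2]
  field_simp
  ring

/-- Raising the upper index in a truncated generating sum of `1 / ((m + 1) * m.choose k)`. -/
lemma add_one_mul_sum_inv_choose_succ (x : ℝ) (m : ℕ) {p : ℕ} (hp : p ≤ m + 1) :
    (x + 1) * ∑ k ∈ Finset.range p, x ^ k * (1 / ((m + 2) * ((m + 1).choose k : ℝ))) =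
      x * ∑ k ∈ Finset.range p, x ^ k * (1 / ((m + 1) * (m.choose k : ℝ))) +
        1 / (m + 2) - x ^ p * (1 / ((m + 2) * ((m + 1).choose p : ℝ))) := by
  induction p with
  | zero => simp
  | succ p ih =>
    rw [Finset.sum_range_succ, Finset.sum_range_succ, mul_add, ih (by omega), mul_add x,
      inv_succ_mul_choose_eq_add (show p ≤ m by omega)]
    ring

/-- Two-step recurrence for the half sums with upper index `2 * n + 1`. -/
lemma sq_mul_half_sum_inv_choose_succ (x : ℝ) (n : ℕ) (hn : 0 < n) :
    (x + 1) ^ 2 * ∑ k ∈ Finset.range (n + 1), x ^ k / ((2 * (n + 1) - 1).choose k : ℝ) =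
      (n + 1) * (x ^ 2 * (∑ k ∈ Finset.range n, x ^ k / ((2 * n - 1).choose k : ℝ)) / n +
        ((4 * n + 3) * x + (2 * n + 1)) / ((n + 1) * (2 * n + 1)) +
        2 * (x - 1) * (x ^ (n + 1) / ((n + 1) * ((2 * (n + 1)).choose (n + 1) : ℝ)))) := by
  obtain ⟨m, rfl⟩ : ∃ m, n = m + 1 := ⟨n - 1, by omega⟩
  have norm_sum (N p : ℕ) : ∑ k ∈ Finset.range p, x ^ k / (N.choose k : ℝ) =
      (N + 1) * ∑ k ∈ Finset.range p, x ^ k * (1 / ((N + 1) * (N.choose k : ℝ))) := by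
    have hN : (N : ℝ) + 1 ≠ 0 := by positivity
    rw [Finset.mul_sum]
    refine Finset.sum_congr rfl fun k _ => ?_
    rw [one_div, mul_inv, mul_left_comm, mul_inv_cancel_left₀ hN, div_eq_mul_inv]
  have s1 := add_one_mul_sum_inv_choose_succ x (2 * m + 1) (p := m + 1) (by omega)
  have s2 := add_one_mul_sum_inv_choose_succ x (2 * m + 2) (p := m + 1) (by omega)
  have hmid : (2 : ℝ) * (2 * m + 3).choose (m + 1) = (2 * m + 4).choose (m + 2) := by
    have h : (2 * m + 4).choose (m + 2) = 2 * (2 * m + 3).choose (m + 1) := by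
      have hsymm : (2 * m + 3).choose (m + 1 + 1) = (2 * m + 3).choose (m + 1) :=
        Nat.choose_symm_of_eq_add (by omega)
      rw [Nat.choose_succ_succ' (2 * m + 3) (m + 1), hsymm, ← two_mul]
    exact_mod_cast h.symm
  have hlow : ((2 * m + 2).choose (m + 1) : ℝ) * (2 * m + 3) =
      (2 * m + 3).choose (m + 1) * (m + 2) := by
    have h := Nat.choose_mul_succ_eq (2 * m + 2) (m + 1)
    rw [show 2 * m + 2 + 1 - (m + 1) = m + 2 by omega] at h
    exact_mod_cast h
  rw [show 2 * (m + 1 + 1) - 1 = 2 * m + 3 by omega, show 2 * (m + 1) - 1 = 2 * m + 1 by omega,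
    show 2 * (m + 1 + 1) = 2 * m + 4 by ring, Finset.sum_range_succ, norm_sum, norm_sum, ← hmid]
  have c0 : ((2 * m + 3).choose (m + 1) : ℝ) ≠ 0 :=
    mod_cast (Nat.choose_pos (by omega)).ne'
  have d3 : (2 * m + 3 : ℝ) ≠ 0 := by positivity
  have e1 : ((2 * m + 2).choose (m + 1) : ℝ) =
      (2 * m + 3).choose (m + 1) * (m + 2) / (2 * m + 3) := by
    rw [eq_div_iff d3, hlow]
  simp only [show 2 * m + 1 + 1 = 2 * m + 2 by ring, show 2 * m + 2 + 1 = 2 * m + 3 by ring, e1]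
    at s1 s2
  push_cast at s1 s2 ⊢
  simp only [show (2 * m + 1 + 1 : ℝ) = 2 * m + 2 by ring,
    show (2 * m + 1 + 2 : ℝ) = 2 * m + 3 by ring, show (2 * m + 2 + 1 : ℝ) = 2 * m + 3 by ring,
    show (2 * m + 2 + 2 : ℝ) = 2 * m + 4 by ring, show (2 * m + 3 + 1 : ℝ) = 2 * m + 4 by ring]
    at s1 s2 ⊢
  generalize ∑ k ∈ Finset.range (m + 1), x ^ k * (1 / ((2 * m + 4) * ((2 * m + 3).choose k : ℝ)))
    = A at *
  generalize ∑ k ∈ Finset.range (m + 1), x ^ k * (1 / ((2 * m + 3) * ((2 * m + 2).choose k : ℝ)))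
    = B at *
  generalize ∑ k ∈ Finset.range (m + 1), x ^ k * (1 / ((2 * m + 2) * ((2 * m + 1).choose k : ℝ)))
    = C at *
  generalize ((2 * m + 3).choose (m + 1) : ℝ) = c at *
  have d1 : (m + 1 : ℝ) ≠ 0 := by positivity
  have d2 : (m + 2 : ℝ) ≠ 0 := by positivity
  have hA : (x + 1) ^ 2 * A = x * (x * C + 1 / (2 * m + 3) -
      x ^ (m + 1) * (1 / ((2 * m + 3) * (c * (m + 2) / (2 * m + 3))))) +
      (x + 1) * (1 / (2 * m + 4) - x ^ (m + 1) * (1 / ((2 * m + 4) * c))) := by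
    linear_combination (x + 1) * s2 + x * s1
  rw [mul_add, mul_left_comm, hA]
  simp only [show (2 * m + 4 : ℝ) = 2 * (m + 2) by ring, show (m + 1 + 1 : ℝ) = m + 2 by ring,
    show (2 * (m + 1) + 1 : ℝ) = 2 * m + 3 by ring, show (2 * m + 2 : ℝ) = 2 * (m + 1) by ring]
  field_simp
  ring

/-- Splitting off the top term of a sum weighted by even powers. -/
lemma sum_Icc_succ_mul_pow_sub (f : ℕ → ℝ) (r : ℝ) (n : ℕ) :
    ∑ k ∈ Finset.Icc 1 (n + 1), f k * r ^ (2 * (n + 1) - 2 * k) =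
      r ^ 2 * ∑ k ∈ Finset.Icc 1 n, f k * r ^ (2 * n - 2 * k) + f (n + 1) := by
  rw [Finset.sum_Icc_succ_top (by omega), Finset.mul_sum, Nat.sub_self, pow_zero, mul_one]
  congr 1
  refine Finset.sum_congr rfl fun k hk => ?_
  have hk' := (Finset.mem_Icc.mp hk).2
  rw [show 2 * (n + 1) - 2 * k = 2 + (2 * n - 2 * k) by omega, pow_add]
  ring


theorem sum_inv_choose_identity' (n : ℕ) (hn : 0 < n) (x : ℝ) (hx : x ≠ -1) :
    ∑ k ∈ Finset.range n, x ^ k / ((2 * n - 1).choose k : ℝ) =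
      ((n : ℝ) / (x + 1) ^ 2) *
        ∑ k ∈ Finset.Icc 1 n,
          (((4 * k - 1 : ℝ) * x + (2 * k - 1 : ℝ)) / ((k : ℝ) * (2 * k - 1 : ℝ))) *
            (x / (x + 1)) ^ (2 * n - 2 * k) +
      (2 * n * (x - 1) / (x + 1) ^ 2) *
        ∑ k ∈ Finset.Icc 1 n,
          (x ^ k / ((k : ℝ) * ((2 * k).choose k : ℝ))) * (x / (x + 1)) ^ (2 * n - 2 * k) := by
  have hx1 : x + 1 ≠ 0 := fun h => hx (by linarith)
  induction n, hn using Nat.le_induction with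
  | base =>
    norm_num
    field_simp
    ring
  | succ n hn ih =>
    have hn0 : (n : ℝ) ≠ 0 := mod_cast (show n ≠ 0 by omega)
    have h := sq_mul_half_sum_inv_choose_succ x n hn
    rw [ih] at h
    rw [sum_Icc_succ_mul_pow_sub (fun k : ℕ => ((4 * k - 1 : ℝ) * x + (2 * k - 1 : ℝ)) /
        ((k : ℝ) * (2 * k - 1 : ℝ))),
      sum_Icc_succ_mul_pow_sub (fun k : ℕ => x ^ k / ((k : ℝ) * ((2 * k).choose k : ℝ)))]
    rw [← mul_right_inj' (pow_ne_zero 2 hx1), h]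
    push_cast
    rw [show (4 * (n + 1) - 1 : ℝ) = 4 * n + 3 by ring,
      show (2 * (n + 1) - 1 : ℝ) = 2 * n + 1 by ring]
    generalize ((4 * n + 3) * x + (2 * n + 1)) / ((n + 1) * (2 * n + 1)) = u
    generalize x ^ (n + 1) / ((n + 1) * ((2 * (n + 1)).choose (n + 1) : ℝ)) = v
    generalize (∑ k ∈ Finset.Icc 1 n, ((4 * k - 1 : ℝ) * x + (2 * k - 1 : ℝ)) /
      ((k : ℝ) * (2 * k - 1 : ℝ)) * (x / (x + 1)) ^ (2 * n - 2 * k)) = P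
    generalize (∑ k ∈ Finset.Icc 1 n, x ^ k / ((k : ℝ) * ((2 * k).choose k : ℝ)) *
      (x / (x + 1)) ^ (2 * n - 2 * k)) = Q
    field_simp
    ring
end

section
/- Let m, d be real numbers with m·d·(m+d) ≠ 0. Then for every positive integer n, ∑_{l=1}^{n} binom(n,l)·binom(n+l,l)·(-1)^l · ∑_{k=1}^{l} (1/(k·binom(2k,k)))·(-(m-d)^2/(m·d))^k = ((d-m)/(d+m))·(-1)^n·( ∑_{k=1}^{n} (-d/m)^k/k − ∑_{k=1}^{n} (-m/d)^k/k ). -/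
theorem sum_Icc_one_eq_sum_range (f : ℕ → ℝ) (n : ℕ) :
    ∑ k ∈ Finset.Icc 1 n, f k = ∑ j ∈ Finset.range n, f (j + 1) := by
  induction n with
  | zero => simp
  | succ n ih => rw [Finset.sum_Icc_succ_top (by omega), ih, Finset.sum_range_succ]

/-- Summation by parts against partial sums. -/
theorem sum_sub_succ_mul_partial_sum (U a : ℕ → ℝ) (n : ℕ) :
    ∑ l ∈ Finset.range (n + 1), (U l - U (l + 1)) * ∑ j ∈ Finset.range l, a j =
      ∑ j ∈ Finset.range n, U (j + 1) * a j - U (n + 1) * ∑ j ∈ Finset.range n, a j := by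
  induction n with
  | zero => simp
  | succ n ih =>
    rw [Finset.sum_range_succ, ih, Finset.sum_range_succ a, Finset.sum_range_succ _ n]
    ring

/-- Closed forms of the two companion polynomials of Chebyshev type in `y = t + 2 + t⁻¹`. -/
theorem sum_choose_pow_closed_form (t s : ℝ) (hts : t * s = 1) (M n : ℕ) (hn : n < M) :
    ((t - s) * ∑ j ∈ Finset.range M,
        (-1 : ℝ) ^ (n + 1 + j) * ((n + j).choose (2 * j + 1) : ℝ) * (t + 2 + s) ^ j =
      t ^ n - s ^ n) ∧
    ((t - s) * ∑ j ∈ Finset.range M,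
        (-1 : ℝ) ^ (n + j) * ((n + j).choose (2 * j) : ℝ) * (t + 2 + s) ^ j =
      t ^ (n + 1) + t ^ n - s ^ (n + 1) - s ^ n) := by
  induction n with
  | zero =>
    obtain ⟨M, rfl⟩ : ∃ k, M = k + 1 := ⟨M - 1, by omega⟩
    have h1 (j : ℕ) : (0 + j).choose (2 * j + 1) = 0 := Nat.choose_eq_zero_of_lt (by omega)
    have h2 (j : ℕ) : (0 + (j + 1)).choose (2 * (j + 1)) = 0 :=
      Nat.choose_eq_zero_of_lt (by omega)
    constructor
    · simp only [h1]; simp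
    · rw [Finset.sum_range_succ']
      simp only [h2]; simp; ring
  | succ n ih =>
    obtain ⟨hW, hZ⟩ := ih (by omega)
    have hW' : (∑ j ∈ Finset.range M, (-1 : ℝ) ^ (n + 1 + 1 + j) *
        ((n + 1 + j).choose (2 * j + 1) : ℝ) * (t + 2 + s) ^ j) =
        (∑ j ∈ Finset.range M,
          (-1 : ℝ) ^ (n + j) * ((n + j).choose (2 * j) : ℝ) * (t + 2 + s) ^ j) -
        ∑ j ∈ Finset.range M,
          (-1 : ℝ) ^ (n + 1 + j) * ((n + j).choose (2 * j + 1) : ℝ) * (t + 2 + s) ^ j := by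
      rw [← Finset.sum_sub_distrib]
      refine Finset.sum_congr rfl fun j _ => ?_
      rw [show n + 1 + j = n + j + 1 by ring, Nat.choose_succ_succ]
      push_cast
      ring
    have hZ' : (∑ j ∈ Finset.range M, (-1 : ℝ) ^ (n + 1 + j) *
        ((n + 1 + j).choose (2 * j) : ℝ) * (t + 2 + s) ^ j) =
        (t + 2 + s) * (∑ j ∈ Finset.range M, (-1 : ℝ) ^ (n + 1 + 1 + j) *
          ((n + 1 + j).choose (2 * j + 1) : ℝ) * (t + 2 + s) ^ j) -
        ∑ j ∈ Finset.range M,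
          (-1 : ℝ) ^ (n + j) * ((n + j).choose (2 * j) : ℝ) * (t + 2 + s) ^ j := by
      obtain ⟨M, rfl⟩ : ∃ k, M = k + 1 := ⟨M - 1, by omega⟩
      rw [Finset.sum_range_succ', Finset.sum_range_succ _ M,
        Finset.sum_range_succ' (fun j => (-1 : ℝ) ^ (n + j) * _ * _) M,
        Nat.choose_eq_zero_of_lt (show n + 1 + M < 2 * M + 1 by omega), mul_add, Finset.mul_sum,
        add_sub_add_comm, ← Finset.sum_sub_distrib]
      congr 1
      · refine Finset.sum_congr rfl fun j _ => ?_
        rw [show n + 1 + (j + 1) = n + 1 + j + 1 by ring, show n + (j + 1) = n + 1 + j by ring,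
          show 2 * (j + 1) = 2 * j + 1 + 1 by ring, Nat.choose_succ_succ]
        push_cast
        ring
      · simp [pow_succ]
    have hWn : (t - s) * (∑ j ∈ Finset.range M, (-1 : ℝ) ^ (n + 1 + 1 + j) *
        ((n + 1 + j).choose (2 * j + 1) : ℝ) * (t + 2 + s) ^ j) = t ^ (n + 1) - s ^ (n + 1) := by
      rw [hW', mul_sub, hZ, hW]
      ring
    refine ⟨hWn, ?_⟩
    rw [hZ', mul_sub, hZ, mul_left_comm, hWn]
    linear_combination (t ^ n - s ^ n) * hts

/-- The difference of consecutive summands is a telescoping difference. -/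
theorem choose_mul_choose_add_eq_sub (n l : ℕ) :
    ((n + 1).choose l : ℝ) * ((n + 1 + l).choose l : ℝ) + (n.choose l : ℝ) * ((n + l).choose l : ℝ)
      = 2 * l ^ 2 * ((n + 1).choose l : ℝ) * ((n + 1 + l).choose l : ℝ) /
          ((n + 1) * (n + 1 + l)) +
        2 * (l + 1) ^ 2 * ((n + 1).choose (l + 1) : ℝ) * ((n + 1 + (l + 1)).choose (l + 1) : ℝ) /
          ((n + 1) * (n + 1 + (l + 1))) := by
  have h1 : (n.choose l : ℝ) * (n + 1) = ((n + 1).choose l : ℝ) * (n + 1 - l) := by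
    rcases le_or_gt l (n + 1) with hl | hl
    · have := Nat.choose_mul_succ_eq n l
      zify [hl] at this
      exact_mod_cast this
    · rw [Nat.choose_eq_zero_of_lt hl, Nat.choose_eq_zero_of_lt (by omega : n < l)]; simp
  have h2 : ((n + 1 + l).choose l : ℝ) * (n + 1) = (n + 1 + l) * ((n + l).choose l : ℝ) := by
    have := Nat.choose_mul_succ_eq (n + l) l
    rw [show n + l + 1 - l = n + 1 by omega, show n + l + 1 = n + 1 + l by ring] at this
    have h := congrArg (Nat.cast (R := ℝ)) this
    push_cast at h
    linarith
  have h3 : ((n + 1).choose (l + 1) : ℝ) * (l + 1) = ((n + 1).choose l : ℝ) * (n + 1 - l) := by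
    rcases le_or_gt l (n + 1) with hl | hl
    · have := Nat.choose_succ_right_eq (n + 1) l
      zify [hl] at this
      exact_mod_cast this
    · rw [Nat.choose_eq_zero_of_lt hl, Nat.choose_eq_zero_of_lt (by omega : n + 1 < l + 1)]; simp
  have h4 : ((n + 1 + (l + 1)).choose (l + 1) : ℝ) * (l + 1) =
      (n + 1 + (l + 1)) * ((n + 1 + l).choose l : ℝ) := by
    have h := congrArg (Nat.cast (R := ℝ)) (Nat.add_one_mul_choose_eq (n + 1 + l) l)
    push_cast [add_assoc] at h ⊢
    linarith
  have e1 : (n.choose l : ℝ) = ((n + 1).choose l : ℝ) * (n + 1 - l) / (n + 1) := by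
    rw [← h1]; field_simp
  have e2 : ((n + l).choose l : ℝ) = ((n + 1 + l).choose l : ℝ) * (n + 1) / (n + 1 + l) := by
    rw [h2]; field_simp
  have e3 : ((n + 1).choose (l + 1) : ℝ) = ((n + 1).choose l : ℝ) * (n + 1 - l) / (l + 1) := by
    rw [← h3]; field_simp
  have e4 : ((n + 1 + (l + 1)).choose (l + 1) : ℝ) =
      (n + 1 + (l + 1)) * ((n + 1 + l).choose l : ℝ) / (l + 1) := by
    rw [← h4]; field_simp
  rw [e1, e2, e3, e4]
  field_simp
  ring

theorem choose_mul_choose_div_centralBinom (n j : ℕ) :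
    2 * ((j : ℝ) + 1) ^ 2 * ((n + 1).choose (j + 1) : ℝ) * ((n + 1 + (j + 1)).choose (j + 1) : ℝ) /
        ((n + 1) * (n + 1 + (j + 1))) *
        (1 / (((j : ℝ) + 1) * ((2 * (j + 1)).choose (j + 1) : ℝ))) =
      ((n + 1 + j).choose (2 * j + 1) : ℝ) / (n + 1) := by
  have h1 : ((n + 1 + (j + 1)).choose (2 * (j + 1)) : ℝ) * ((2 * (j + 1)).choose (j + 1) : ℝ) =
      ((n + 1 + (j + 1)).choose (j + 1) : ℝ) * ((n + 1).choose (j + 1) : ℝ) := by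
    have := Nat.choose_mul (n := n + 1 + (j + 1)) (k := 2 * (j + 1)) (s := j + 1) (by omega)
    rw [show n + 1 + (j + 1) - (j + 1) = n + 1 by omega,
      show 2 * (j + 1) - (j + 1) = j + 1 by omega] at this
    exact_mod_cast this
  have h2 : ((n : ℝ) + 1 + (j + 1)) * ((n + 1 + j).choose (2 * j + 1) : ℝ) =
      ((n + 1 + (j + 1)).choose (2 * (j + 1)) : ℝ) * (2 * (j + 1)) := by
    have := Nat.add_one_mul_choose_eq (n + 1 + j) (2 * j + 1)
    have h := congrArg (Nat.cast (R := ℝ)) this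
    rw [show n + 1 + j + 1 = n + 1 + (j + 1) by ring,
      show 2 * j + 1 + 1 = 2 * (j + 1) by ring] at h
    push_cast at h ⊢
    linarith
  have hc : ((2 * (j + 1)).choose (j + 1) : ℝ) ≠ 0 := by
    exact_mod_cast (Nat.choose_pos (by omega)).ne'
  have e : ((n + 1 + j).choose (2 * j + 1) : ℝ) =
      ((n + 1 + (j + 1)).choose (2 * (j + 1)) : ℝ) * (2 * (j + 1)) / (n + 1 + (j + 1)) := by
    rw [← h2]; field_simp
  rw [e, mul_assoc (2 * ((j : ℝ) + 1) ^ 2), mul_comm ((n + 1).choose (j + 1) : ℝ), ← h1]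
  field_simp

/-- The double sum identity in the variables `t` and `s = t⁻¹`. -/
theorem sum_choose_mul_partial_sum (t s : ℝ) (hts : t * s = 1) (n : ℕ) :
    (t - 1) * ∑ l ∈ Finset.range (n + 1),
        (n.choose l : ℝ) * ((n + l).choose l : ℝ) * (-1 : ℝ) ^ l *
          ∑ j ∈ Finset.range l,
            (1 / (((j : ℝ) + 1) * ((2 * (j + 1)).choose (j + 1) : ℝ))) * (t + 2 + s) ^ (j + 1) =
      (t + 1) * (-1 : ℝ) ^ n *
        (∑ j ∈ Finset.range n, t ^ (j + 1) / ((j : ℝ) + 1) -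
          ∑ j ∈ Finset.range n, s ^ (j + 1) / ((j : ℝ) + 1)) := by
  induction n with
  | zero => simp
  | succ n ih =>
    set a : ℕ → ℝ := fun j =>
      (1 / (((j : ℝ) + 1) * ((2 * (j + 1)).choose (j + 1) : ℝ))) * (t + 2 + s) ^ (j + 1) with ha
    set U : ℕ → ℝ := fun l => (-1) ^ l * (2 * l ^ 2 * ((n + 1).choose l : ℝ) *
      ((n + 1 + l).choose l : ℝ) / ((n + 1) * (n + 1 + l))) with hU
    have hsum : (∑ l ∈ Finset.range (n + 1 + 1),
        ((n + 1).choose l : ℝ) * ((n + 1 + l).choose l : ℝ) * (-1 : ℝ) ^ l *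
          ∑ j ∈ Finset.range l, a j) +
        ∑ l ∈ Finset.range (n + 1), (n.choose l : ℝ) * ((n + l).choose l : ℝ) * (-1 : ℝ) ^ l *
          ∑ j ∈ Finset.range l, a j = ∑ j ∈ Finset.range (n + 1), U (j + 1) * a j := by
      have hlast : U (n + 1 + 1) = 0 := by simp [hU]
      have h := sum_sub_succ_mul_partial_sum U a (n + 1)
      rw [hlast, zero_mul, sub_zero] at h
      have hext : (∑ l ∈ Finset.range (n + 1),
          (n.choose l : ℝ) * ((n + l).choose l : ℝ) * (-1 : ℝ) ^ l * ∑ j ∈ Finset.range l, a j) =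
          ∑ l ∈ Finset.range (n + 1 + 1),
          (n.choose l : ℝ) * ((n + l).choose l : ℝ) * (-1 : ℝ) ^ l *
            ∑ j ∈ Finset.range l, a j := by
        rw [Finset.sum_range_succ _ (n + 1)]
        simp
      rw [← h, hext, ← Finset.sum_add_distrib]
      refine Finset.sum_congr rfl fun l _ => ?_
      rw [← add_mul, ← add_mul, choose_mul_choose_add_eq_sub]
      simp only [hU]
      push_cast
      ring
    have hV : (t - 1) * ∑ j ∈ Finset.range (n + 1), U (j + 1) * a j =
        (t + 1) * (-1) ^ (n + 1) * (t ^ (n + 1) / ((n : ℝ) + 1) - s ^ (n + 1) / ((n : ℝ) + 1)) := by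
      have hterm : ∑ j ∈ Finset.range (n + 1), U (j + 1) * a j =
          (-1) ^ (n + 1) * (t + 2 + s) / (n + 1) * ∑ j ∈ Finset.range (n + 1),
            (-1 : ℝ) ^ (n + 1 + 1 + j) * ((n + 1 + j).choose (2 * j + 1) : ℝ) *
              (t + 2 + s) ^ j := by
        rw [Finset.mul_sum]
        refine Finset.sum_congr rfl fun j _ => ?_
        have h := choose_mul_choose_div_centralBinom n j
        have hs : ((-1 : ℝ) ^ (n + 1)) * (-1) ^ (n + 1) = 1 := by
          rw [← mul_pow]; simp
        simp only [hU, ha]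
        push_cast
        calc _ = (-1 : ℝ) ^ (j + 1) * (t + 2 + s) ^ (j + 1) *
              (((n + 1 + j).choose (2 * j + 1) : ℝ) / (n + 1)) := by rw [← h]; ring
          _ = ((-1 : ℝ) ^ (n + 1)) * (-1) ^ (n + 1) * ((-1 : ℝ) ^ (j + 1) * (t + 2 + s) ^ (j + 1) *
              (((n + 1 + j).choose (2 * j + 1) : ℝ) / (n + 1))) := by rw [hs, one_mul]
          _ = _ := by ring
      have hW := (sum_choose_pow_closed_form t s hts (n + 2) (n + 1) (by omega)).1
      rw [Finset.sum_range_succ, Nat.choose_eq_zero_of_lt (by omega : n + 1 + (n + 1) < _),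
        Nat.cast_zero, mul_zero, zero_mul, add_zero] at hW
      rw [hterm, ← sub_div, ← hW]
      have hy : (t - 1) * (t + 2 + s) = (t + 1) * (t - s) := by linear_combination 2 * hts
      linear_combination ((-1) ^ (n + 1) / (n + 1) * ∑ j ∈ Finset.range (n + 1),
        (-1 : ℝ) ^ (n + 1 + 1 + j) * ((n + 1 + j).choose (2 * j + 1) : ℝ) *
          (t + 2 + s) ^ j) * hy
    rw [eq_sub_of_add_eq hsum, mul_sub, ih, hV, Finset.sum_range_succ _ n,
      Finset.sum_range_succ _ n]
    ring

theorem sum_double_sum_identity (m d : ℝ) (h : m * d * (m + d) ≠ 0)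
    (n : ℕ) (hn : 0 < n) :
    ∑ l ∈ Finset.Icc 1 n,
        (n.choose l : ℝ) * ((n + l).choose l : ℝ) * (-1 : ℝ) ^ l *
          ∑ k ∈ Finset.Icc 1 l,
            (1 / ((k : ℝ) * ((2 * k).choose k : ℝ))) * (-(m - d) ^ 2 / (m * d)) ^ k =
      ((d - m) / (d + m)) * (-1 : ℝ) ^ n *
        (∑ k ∈ Finset.Icc 1 n, (-d / m) ^ k / (k : ℝ) -
          ∑ k ∈ Finset.Icc 1 n, (-m / d) ^ k / (k : ℝ)) := by
  have hm : m ≠ 0 := by rintro rfl; simp at h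
  have hd : d ≠ 0 := by rintro rfl; simp at h
  have hdm : d + m ≠ 0 := by rw [add_comm]; exact right_ne_zero_of_mul h
  have key := sum_choose_mul_partial_sum (-d / m) (-m / d) (by field_simp) n
  have hy : -(m - d) ^ 2 / (m * d) = -d / m + 2 + -m / d := by field_simp; ring
  rw [Finset.sum_range_succ'] at key
  simp only [sum_Icc_one_eq_sum_range, hy]
  push_cast at key ⊢
  simp only [Finset.range_zero, Finset.sum_empty, mul_zero, add_zero] at key
  have ht : -d / m - 1 ≠ 0 := by
    rw [show -d / m - 1 = -(d + m) / m by field_simp; ring]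
    exact div_ne_zero (neg_ne_zero.mpr hdm) hm
  have hr : (d - m) / (d + m) * (-d / m - 1) = -d / m + 1 := by field_simp; ring
  refine mul_left_cancel₀ ht ?_
  rw [key, ← hr]
  ring
end

section
/- Let p be an odd prime and let x be a p-adic integer (in particular x may be any integer). Then ∑_{k=1}^{(p-1)/2} (1-x)^k / k ≡ H_{(p-1)/2} + S_{p-1}(x/4) (mod p), where H_{(p-1)/2} = ∑_{k=1}^{(p-1)/2} 1/k and S_{p-1}(x/4) = ∑_{k=1}^{p-1} binom(2k,k)·(x/4)^k / k; all terms are p-adic integers since the denominators k ≤ p-1 and the factor 4 are invertible modulo p. -/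
open Finset in
/-- Integrated form of the binomial theorem:
`∑ (1 - x) ^ k / k = H_n + ∑ (n choose k) (-x) ^ k / k`. -/
theorem sum_one_sub_pow_div_eq {K : Type*} [Field K] [CharZero K] (x : K) (n : ℕ) :
    ∑ k ∈ Icc 1 n, (1 - x) ^ k / (k : K) =
      ∑ k ∈ Icc 1 n, (1 : K) / k + ∑ k ∈ Icc 1 n, (n.choose k : K) * (-x) ^ k / k := by
  induction n with
  | zero => simp
  | succ n ih =>
    have hn : (n : K) + 1 ≠ 0 := by exact_mod_cast n.succ_ne_zero
    have hext : ∑ k ∈ Icc 1 n, (n.choose k : K) * (-x) ^ k / k =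
        ∑ k ∈ Icc 1 (n + 1), (n.choose k : K) * (-x) ^ k / k := by
      rw [sum_Icc_succ_top (by lia)]
      simp
    have hdiff : ∑ k ∈ Icc 1 (n + 1), ((n + 1).choose k : K) * (-x) ^ k / k -
        ∑ k ∈ Icc 1 (n + 1), (n.choose k : K) * (-x) ^ k / k =
        ((1 - x) ^ (n + 1) - 1) / (n + 1) := by
      have hbinom : (1 - x) ^ (n + 1) - 1 =
          ∑ k ∈ Icc 1 (n + 1), ((n + 1).choose k : K) * (-x) ^ k := by
        rw [sub_eq_neg_add 1 x, add_pow, sum_range_succ', ← Ico_add_one_right_eq_Icc,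
          sum_Ico_eq_sum_range]
        simp [mul_comm, add_comm]
      rw [hbinom, ← sum_sub_distrib, sum_div]
      refine sum_congr rfl fun k hk ↦ ?_
      obtain ⟨j, rfl⟩ := Nat.exists_eq_add_of_le' (mem_Icc.1 hk).1
      have hj : ((j + 1 : ℕ) : K) ≠ 0 := by exact_mod_cast j.succ_ne_zero
      have h₁ : ((n + 1).choose (j + 1) : K) = n.choose j + n.choose (j + 1) := by
        exact_mod_cast Nat.choose_succ_succ n j
      have h₂ : ((n : K) + 1) * n.choose j = (n + 1).choose (j + 1) * (j + 1 : ℕ) := by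
        exact_mod_cast Nat.add_one_mul_choose_eq n j
      rw [← sub_div, div_eq_div_iff hj hn]
      linear_combination (-x) ^ (j + 1) * (h₂ + ((n : K) + 1) * h₁)
    rw [sum_Icc_succ_top (by lia), ih, hext, sum_Icc_succ_top (by lia : 1 ≤ n + 1)
      (fun k ↦ (1 : K) / k)]
    push_cast
    linear_combination -hdiff

/-- Modulo `p = 2 n + 1`, the `k`-th central binomial coefficient is `(-4) ^ k * (n choose k)`. -/
theorem centralBinom_eq_neg_four_pow_mul_choose {p n k : ℕ} [Fact p.Prime] (hp : p = 2 * n + 1)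
    (hk : k < p) : (k.centralBinom : ZMod p) = (-4) ^ k * n.choose k := by
  induction k with
  | zero => simp
  | succ k ih =>
    have hk₀ : ((k + 1 : ℕ) : ZMod p) ≠ 0 := by
      rw [Ne, ZMod.natCast_eq_zero_iff]
      exact Nat.not_dvd_of_pos_of_lt k.succ_pos hk
    have hn : (2 : ZMod p) * n + 1 = 0 := by
      exact_mod_cast (congrArg (Nat.cast : ℕ → ZMod p) hp).symm.trans (ZMod.natCast_self p)
    have h₁ : ((k + 1 : ℕ) : ZMod p) * (k + 1).centralBinom =
        2 * (2 * k + 1) * k.centralBinom := by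
      exact_mod_cast congrArg (Nat.cast : ℕ → ZMod p) (Nat.succ_mul_centralBinom_succ k)
    have h₂ : (n.choose (k + 1) : ZMod p) * (k + 1 : ℕ) = n.choose k * (n - k) := by
      rcases le_or_gt k n with h | h
      · rw [← Nat.cast_sub h]
        exact_mod_cast congrArg (Nat.cast : ℕ → ZMod p) (Nat.choose_succ_right_eq n k)
      · simp [Nat.choose_eq_zero_of_lt h, Nat.choose_eq_zero_of_lt (h.trans k.lt_succ_self)]
    apply mul_left_cancel₀ hk₀
    rw [h₁, ih (by lia)]
    linear_combination -(-4) ^ (k + 1) * h₂ + 2 * (-4) ^ k * (n.choose k : ZMod p) * hn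

theorem choose_mul_neg_pow_sub_centralBinom_mul_div_four_pow {K : Type*} [Field K] [CharZero K]
    (x : K) (n k : ℕ) :
    (n.choose k : K) * (-x) ^ k - k.centralBinom * (x / 4) ^ k =
      ((-4) ^ k * n.choose k - k.centralBinom) * (x ^ k / 4 ^ k) := by
  rw [neg_pow x, neg_pow (4 : K), div_pow]
  field_simp

theorem norm_intCast_padic_le_inv_of_dvd {p : ℕ} [Fact p.Prime] {m : ℤ} (h : (p : ℤ) ∣ m) :
    ‖(m : ℚ_[p])‖ ≤ (p : ℝ)⁻¹ := by
  have := (Padic.norm_int_le_pow_iff_dvd (p := p) m 1).2 (by rwa [pow_one])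
  rwa [Nat.cast_one, zpow_neg_one] at this

theorem sum_one_sub_x_pow_div (p : ℕ) [Fact p.Prime] (hodd : Odd p)
    (x : ℚ_[p]) (hx : ‖x‖ ≤ 1) :
    ‖(∑ k ∈ Finset.Icc 1 ((p - 1) / 2), (1 - x) ^ k / (k : ℚ_[p])) -
      ((∑ k ∈ Finset.Icc 1 ((p - 1) / 2), (1 : ℚ_[p]) / k) +
        ∑ k ∈ Finset.Icc 1 (p - 1),
          ((2 * k).choose k : ℚ_[p]) * (x / 4) ^ k / (k : ℚ_[p]))‖ ≤
      (p : ℝ)⁻¹ := by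
  obtain ⟨n, hn⟩ := hodd
  have hn' : (p - 1) / 2 = n := by lia
  have hext : ∑ k ∈ Finset.Icc 1 n, (n.choose k : ℚ_[p]) * (-x) ^ k / k =
      ∑ k ∈ Finset.Icc 1 (p - 1), (n.choose k : ℚ_[p]) * (-x) ^ k / k := by
    refine Finset.sum_subset (Finset.Icc_subset_Icc_right (by lia)) fun k hk hk' ↦ ?_
    have : n < k := by
      simp only [Finset.mem_Icc] at hk hk'
      lia
    simp [Nat.choose_eq_zero_of_lt this]
  rw [hn', sum_one_sub_pow_div_eq, add_sub_add_left_eq_sub, hext, ← Finset.sum_sub_distrib]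
  refine IsUltrametricDist.norm_sum_le_of_forall_le_of_nonneg (by positivity) fun k hk ↦ ?_
  rw [Finset.mem_Icc] at hk
  have hterm : (n.choose k : ℚ_[p]) * (-x) ^ k / k - ((2 * k).choose k : ℚ_[p]) * (x / 4) ^ k / k =
      (((-4) ^ k * n.choose k - k.centralBinom : ℤ) : ℚ_[p]) * (x ^ k / (4 ^ k * k)) := by
    have h := choose_mul_neg_pow_sub_centralBinom_mul_div_four_pow x n k
    push_cast
    rw [← sub_div, ← Nat.centralBinom_eq_two_mul_choose, h, mul_div_assoc, div_div]
  have hdvd : (p : ℤ) ∣ (-4) ^ k * n.choose k - k.centralBinom := by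
    rw [← ZMod.intCast_zmod_eq_zero_iff_dvd]
    push_cast
    rw [centralBinom_eq_neg_four_pow_mul_choose hn (by lia), sub_self]
  have hint : ‖(((-4) ^ k * n.choose k - k.centralBinom : ℤ) : ℚ_[p])‖ ≤ (p : ℝ)⁻¹ :=
    norm_intCast_padic_le_inv_of_dvd hdvd
  have hknorm : ‖(k : ℚ_[p])‖ = 1 := by
    rw [Padic.norm_natCast_eq_one_iff]
    exact Nat.coprime_of_lt_prime (by lia) (by lia) Fact.out
  have hfour : ‖(4 : ℚ_[p])‖ = 1 := by
    have hp2 : p.Coprime (2 ^ 2) := (Nat.coprime_two_right.2 ⟨n, hn⟩).pow_right 2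
    exact_mod_cast Padic.norm_natCast_eq_one_iff.2 hp2
  rw [hterm, norm_mul, norm_div, norm_mul, norm_pow, norm_pow, hknorm, hfour, one_pow, mul_one,
    div_one]
  exact (mul_le_of_le_one_right (norm_nonneg _) (pow_le_one₀ (norm_nonneg x) hx)).trans hint
end

section
/- Let p be an odd prime, let l be an integer with 1 ≤ l ≤ (p-1)/2, and let k be an integer with 0 ≤ k ≤ 2l - 1. Then 2l · binom(2l-1,k) · binom(p+k, 2l) ≡ p·(-1)^{k+1} (mod p^2); equivalently, binom(p+k,2l) ≡ (p/(2l))·(-1)^{k+1}/binom(2l-1,k) (mod p^2) as p-adic integers. -/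
theorem natCast_add_one_ascFactorial_zmod (p k : ℕ) :
    (((p + 1).ascFactorial k : ℕ) : ZMod p) = (k.factorial : ZMod p) := by
  induction k with
  | zero => simp
  | succ k ih =>
    rw [Nat.ascFactorial_succ, Nat.factorial_succ]
    push_cast
    rw [ih, ZMod.natCast_self]
    ring

theorem natCast_sub_one_descFactorial_zmod (p j : ℕ) (hj : j < p) :
    (((p - 1).descFactorial j : ℕ) : ZMod p) = (-1) ^ j * (j.factorial : ZMod p) := by
  induction j with
  | zero => simp
  | succ j ih =>
    have h : ((p - 1 - j : ℕ) : ZMod p) = -(j + 1) := by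
      rw [Nat.sub_sub, Nat.cast_sub (by omega), ZMod.natCast_self]
      push_cast
      ring
    rw [Nat.descFactorial_succ, Nat.factorial_succ, Nat.cast_mul, ih (by omega), h]
    push_cast
    ring

theorem add_descFactorial_eq (p k j : ℕ) (hp : 0 < p) :
    (p + k).descFactorial (k + j + 1) =
      p * ((p - 1).descFactorial j * (p + 1).ascFactorial k) := by
  obtain ⟨q, rfl⟩ : ∃ q, p = q + 1 := ⟨p - 1, by omega⟩
  rw [← Nat.descFactorial_mul_descFactorial (show k ≤ k + j + 1 by omega),
    Nat.add_sub_cancel, show k + j + 1 - k = j + 1 by omega,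
    Nat.succ_descFactorial_succ, Nat.add_descFactorial_eq_ascFactorial, Nat.add_sub_cancel,
    mul_assoc]

/-- For `k + j < p`, modulo `p ^ 2` the product of the `k + j + 1` consecutive integers from
`p - j` to `p + k` is `p * (-1) ^ j * j! * k!`; dividing by `j! * k!` gives this congruence. -/
theorem succ_mul_choose_mul_choose_modEq (p k j : ℕ) (hp : p.Prime) (h : k + j < p) :
    ((k + j + 1 : ℕ) : ℤ) * ((k + j).choose k : ℤ) * ((p + k).choose (k + j + 1) : ℤ) ≡
      (p : ℤ) * (-1 : ℤ) ^ j [ZMOD ((p : ℤ) ^ 2)] := by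
  have hcop : IsCoprime ((p : ℤ) ^ 2) ((j.factorial * k.factorial : ℕ) : ℤ) := by
    rw [← Nat.cast_pow, Nat.isCoprime_iff_coprime]
    exact ((hp.coprime_factorial_of_lt (by omega)).mul_right
      (hp.coprime_factorial_of_lt (by omega))).pow_left 2
  have key : ((k + j + 1) * (k + j).choose k * (p + k).choose (k + j + 1)) *
      (j.factorial * k.factorial) =
      p * ((p - 1).descFactorial j * (p + 1).ascFactorial k) := by
    rw [← add_descFactorial_eq p k j hp.pos, Nat.descFactorial_eq_factorial_mul_choose,
      Nat.factorial_succ, ← Nat.choose_mul_factorial_mul_factorial (Nat.le_add_right k j),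
      Nat.add_sub_cancel_left]
    ring
  have hdiv : (p : ℤ) ∣ (-1) ^ j * ((j.factorial * k.factorial : ℕ) : ℤ) -
      (((p - 1).descFactorial j * (p + 1).ascFactorial k : ℕ) : ℤ) := by
    rw [← ZMod.intCast_zmod_eq_zero_iff_dvd _ p]
    push_cast
    rw [natCast_add_one_ascFactorial_zmod, natCast_sub_one_descFactorial_zmod p j (by omega)]
    ring
  rw [Int.modEq_iff_dvd]
  refine hcop.dvd_of_dvd_mul_right ?_
  have key' := congrArg (Nat.cast : ℕ → ℤ) key
  rw [Nat.cast_mul _ (j.factorial * k.factorial), Nat.cast_mul p] at key'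
  rw [← Nat.cast_mul, ← Nat.cast_mul, sub_mul, key', mul_assoc, ← mul_sub, sq]
  exact mul_dvd_mul_left _ hdiv

theorem choose_p_add_k_congr (p : ℕ) (hp : p.Prime) (hodd : Odd p)
    (l k : ℕ) (hl1 : 1 ≤ l) (hl2 : l ≤ (p - 1) / 2) (hk : k ≤ 2 * l - 1) :
    ((2 * l : ℤ) * ((2 * l - 1).choose k : ℤ) * ((p + k).choose (2 * l) : ℤ)) ≡
      (p : ℤ) * (-1 : ℤ) ^ (k + 1) [ZMOD ((p : ℤ) ^ 2)] := by
  obtain ⟨j, hj⟩ := Nat.exists_eq_add_of_le hk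
  have hl : 2 * l = k + j + 1 := by omega
  have hsign : (-1 : ℤ) ^ (k + 1) = (-1) ^ j :=
    neg_one_pow_congr (by rw [Nat.even_iff, Nat.even_iff]; omega)
  have h := succ_mul_choose_mul_choose_modEq p k j hp (by omega)
  rw [← hl, ← hj] at h
  rw [hsign]
  exact_mod_cast h
end

section
/- Let p be an odd prime, let l be an integer with 0 ≤ l ≤ (p-1)/2, and let k be an integer with 0 ≤ k ≤ p - 2l - 1. Then binom(p-2l-1, k) ≡ (-1)^k · binom(2l+k, k) · (1 − p·(H_{2l+k} − H_{2l})) (mod p^2), where H_j = ∑_{i=1}^{j} 1/i; the right-hand side is a p-adic integer since all indices i in the harmonic sums satisfy i ≤ p-1. -/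
/-- The `n`-th harmonic number `H_n = ∑_{k=1}^n 1/k` (with `H_0 = 0`), in `ℚ_[p]`. -/
noncomputable def harmonicNumPadic (p : ℕ) [Fact p.Prime] (n : ℕ) : ℚ_[p] :=
  ∑ k ∈ Finset.Icc 1 n, (1 : ℚ_[p]) / k

theorem Padic.norm_sub_le_max {p : ℕ} [Fact p.Prime] (x y : ℚ_[p]) :
    ‖x - y‖ ≤ max ‖x‖ ‖y‖ := by
  simpa [sub_eq_add_neg] using Padic.nonarchimedean x (-y)

theorem Padic.norm_natCast_eq_one_of_pos_of_lt {p : ℕ} [Fact p.Prime] {n : ℕ} (h0 : 0 < n)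
    (hn : n < p) : ‖(n : ℚ_[p])‖ = 1 :=
  Padic.norm_natCast_eq_one_iff.2 (Nat.coprime_of_lt_prime h0.ne' hn Fact.out)

theorem harmonicNumPadic_succ (p : ℕ) [Fact p.Prime] (n : ℕ) :
    harmonicNumPadic p (n + 1) = harmonicNumPadic p n + 1 / ((n + 1 : ℕ) : ℚ_[p]) :=
  Finset.sum_Icc_succ_top (by omega) _

theorem norm_harmonicNumPadic_le_one {p : ℕ} [Fact p.Prime] {n : ℕ} (hn : n < p) :
    ‖harmonicNumPadic p n‖ ≤ 1 := by
  induction n with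
  | zero => simp [harmonicNumPadic]
  | succ n ih =>
    rw [harmonicNumPadic_succ]
    refine (Padic.nonarchimedean _ _).trans (max_le (ih (by omega)) ?_)
    rw [norm_div, Padic.norm_natCast_eq_one_of_pos_of_lt n.succ_pos hn]
    simp

theorem norm_choose_sub_neg_one_pow_mul_choose_le {p : ℕ} [Fact p.Prime] {m k : ℕ}
    (h : m + k < p) :
    ‖((p - m - 1).choose k : ℚ_[p]) -
      (-1 : ℚ_[p]) ^ k * ((m + k).choose k : ℚ_[p]) *
        (1 - (p : ℚ_[p]) * (harmonicNumPadic p (m + k) - harmonicNumPadic p m))‖ ≤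
      (p : ℝ)⁻¹ ^ 2 := by
  induction k with
  | zero => simp
  | succ k ih =>
    have ih := ih (by omega)
    have hk : ‖((k + 1 : ℕ) : ℚ_[p])‖ = 1 :=
      Padic.norm_natCast_eq_one_of_pos_of_lt k.succ_pos (by omega)
    have hc0 : ((m + k + 1 : ℕ) : ℚ_[p]) ≠ 0 := by
      exact_mod_cast (m + k).succ_ne_zero
    have hleft : ((p - m - 1).choose (k + 1) : ℚ_[p]) * (k + 1 : ℕ) =
        (p - m - 1).choose k * ((p : ℚ_[p]) - (m + k + 1 : ℕ)) := by
      rw [← Nat.cast_sub (by omega), show p - (m + k + 1) = p - m - 1 - k by omega]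
      exact_mod_cast Nat.choose_succ_right_eq (p - m - 1) k
    have hright : ((m + k + 1).choose (k + 1) : ℚ_[p]) * (k + 1 : ℕ) =
        (m + k + 1 : ℕ) * (m + k).choose k := by
      exact_mod_cast (Nat.add_one_mul_choose_eq (m + k) k).symm
    have hH : ‖harmonicNumPadic p (m + k) - harmonicNumPadic p m‖ ≤ 1 :=
      (Padic.norm_sub_le_max _ _).trans (max_le
        (norm_harmonicNumPadic_le_one (by omega)) (norm_harmonicNumPadic_le_one (by omega)))
    have hpc : ‖(p : ℚ_[p]) - (m + k + 1 : ℕ)‖ ≤ 1 := by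
      rw [← Nat.cast_sub (by omega)]
      exact IsUltrametricDist.norm_natCast_le_one _ _
    have hbinom : ‖((m + k).choose k : ℚ_[p])‖ ≤ 1 := IsUltrametricDist.norm_natCast_le_one _ _
    rw [← add_assoc, harmonicNumPadic_succ, ← mul_one ‖_‖, ← hk, ← norm_mul,
      add_sub_right_comm]
    generalize harmonicNumPadic p (m + k) - harmonicNumPadic p m = d at *
    have key : (((p - m - 1).choose (k + 1) : ℚ_[p]) -
        (-1 : ℚ_[p]) ^ (k + 1) * ((m + k + 1).choose (k + 1) : ℚ_[p]) *
          (1 - (p : ℚ_[p]) * (d + 1 / ((m + k + 1 : ℕ) : ℚ_[p])))) * (k + 1 : ℕ) =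
        (((p - m - 1).choose k : ℚ_[p]) -
          (-1 : ℚ_[p]) ^ k * ((m + k).choose k : ℚ_[p]) * (1 - (p : ℚ_[p]) * d)) *
            ((p : ℚ_[p]) - (m + k + 1 : ℕ)) -
          (-1 : ℚ_[p]) ^ k * ((m + k).choose k : ℚ_[p]) * d * (p : ℚ_[p]) ^ 2 := by
      have hinv := mul_one_div_cancel hc0
      generalize 1 / ((m + k + 1 : ℕ) : ℚ_[p]) = c at *
      linear_combination hleft + (-1 : ℚ_[p]) ^ k * (1 - (p : ℚ_[p]) * (d + c)) * hright -
        (-1 : ℚ_[p]) ^ k * (p : ℚ_[p]) * ((m + k).choose k : ℚ_[p]) * hinv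
    rw [key]
    refine (Padic.norm_sub_le_max _ _).trans (max_le ?_ ?_)
    · rw [norm_mul]
      exact (mul_le_of_le_one_right (norm_nonneg _) hpc).trans ih
    · rw [norm_mul, norm_mul, norm_mul, norm_pow, norm_pow, norm_neg, norm_one, one_pow, one_mul,
        Padic.norm_p]
      exact mul_le_of_le_one_left (by positivity) (mul_le_one₀ hbinom (norm_nonneg _) hH)

theorem choose_p_sub_congr (p : ℕ) [Fact p.Prime] (hodd : Odd p)
    (l k : ℕ) (hl : l ≤ (p - 1) / 2) (hk : k ≤ p - 2 * l - 1) :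
    ‖((p - 2 * l - 1).choose k : ℚ_[p]) -
      (-1 : ℚ_[p]) ^ k * ((2 * l + k).choose k : ℚ_[p]) *
        (1 - (p : ℚ_[p]) * (harmonicNumPadic p (2 * l + k) - harmonicNumPadic p (2 * l)))‖ ≤
      (p : ℝ)⁻¹ ^ 2 := by
  have := (Fact.out : p.Prime).pos
  exact norm_choose_sub_neg_one_pow_mul_choose_le (by omega)
end
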